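/- arXiv:2603.08886 — 4 statements merged into one kernel-verified Lean document; each statement's English description precedes it below -/
import Mathlib

section
/- Let W be a memoryless surjective channel on finite alphabets 𝒳 and 𝒴. Then there exists δ > 0 such that for every W-centered δ-approximately memoryless POST channel Q, the non-feedback capacity functional equals the feedback capacity functional: lim_{n→∞} C_n(Q) = C*_f(Q). -/
open scoped BigOperators

noncomputable section

/-- Conditional mutual information `I(A;B|C)` for a joint pmf `P` on finite types,
with the conventions `0 · log 0 = 0` (and division by zero equal to zero)
and natural logarithm. -/
def condMI {A B C : Type*} [Fintype A] [Fintype B] [Fintype C]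
    (P : A → B → C → ℝ) : ℝ :=
  ∑ a : A, ∑ b : B, ∑ c : C,
    P a b c *
      Real.log ((P a b c * ∑ a' : A, ∑ b' : B, P a' b' c) /
        ((∑ b' : B, P a b' c) * (∑ a' : A, P a' b c)))

/-- `Q x y' y` represents the POST-channel transition kernel `Q(y | x, y')`. -/
def IsPOST {X Y : Type*} [Fintype X] [Fintype Y] (Q : X → Y → Y → ℝ) : Prop :=
  (∀ x y' y, 0 ≤ Q x y' y) ∧ ∀ x y', ∑ y : Y, Q x y' y = 1

/-- A joint pmf `P(x, y')` on `X × Y`. -/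
def IsJointPmf {X Y : Type*} [Fintype X] [Fintype Y] (P : X → Y → ℝ) : Prop :=
  (∀ x y, 0 ≤ P x y) ∧ ∑ x : X, ∑ y : Y, P x y = 1

/-- The stationarity constraint `∑_{x,y'} P(x,y') Q(y|x,y') = ∑_x P(x,y)` for all `y`. -/
def StationaryFor {X Y : Type*} [Fintype X] [Fintype Y]
    (Q : X → Y → Y → ℝ) (P : X → Y → ℝ) : Prop :=
  ∀ y : Y, ∑ x : X, ∑ y' : Y, P x y' * Q x y' y = ∑ x : X, P x y

/-- `I(X;Y|Y')` computed under the joint law `P(x,y') Q(y|x,y')`. -/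
def fbMI {X Y : Type*} [Fintype X] [Fintype Y]
    (Q : X → Y → Y → ℝ) (P : X → Y → ℝ) : ℝ :=
  condMI (fun (x : X) (y : Y) (y' : Y) => P x y' * Q x y' y)

/-- `P` is a maximizer of the optimization problem defining `C*_f(Q)`. -/
def IsFbMaximizer {X Y : Type*} [Fintype X] [Fintype Y]
    (Q : X → Y → Y → ℝ) (P : X → Y → ℝ) : Prop :=
  IsJointPmf P ∧ StationaryFor Q P ∧
    ∀ P' : X → Y → ℝ, IsJointPmf P' → StationaryFor Q P' → fbMI Q P' ≤ fbMI Q P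

/-- The feedback capacity functional `C*_f(Q)`. -/
def Cfstar {X Y : Type*} [Fintype X] [Fintype Y] (Q : X → Y → Y → ℝ) : ℝ :=
  sSup {r : ℝ | ∃ P : X → Y → ℝ, IsJointPmf P ∧ StationaryFor Q P ∧ fbMI Q P = r}

/-- The state preceding time `t` in a length-`n` block with initial state `y0`. -/
def prevState {Y : Type*} (n : ℕ) (y0 : Y) (ys : Fin n → Y) (t : Fin n) : Y :=
  if (t : ℕ) = 0 then y0
  else ys ⟨(t : ℕ) - 1, lt_of_le_of_lt (Nat.sub_le _ _) t.isLt⟩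

/-- A joint pmf `P(x^n, y_0)` on `𝒳^n × 𝒴`. -/
def IsJointPmfN {X Y : Type*} [Fintype X] [Fintype Y] (n : ℕ)
    (P : (Fin n → X) → Y → ℝ) : Prop :=
  (∀ xs y0, 0 ≤ P xs y0) ∧ ∑ xs : Fin n → X, ∑ y0 : Y, P xs y0 = 1

/-- The induced joint law `P(x^n,y_0) ∏_{t=1}^n Q(y_t|x_t,y_{t-1})`. -/
def nLaw {X Y : Type*} [Fintype X] [Fintype Y]
    (Q : X → Y → Y → ℝ) (n : ℕ) (P : (Fin n → X) → Y → ℝ) :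
    (Fin n → X) → (Fin n → Y) → Y → ℝ :=
  fun xs ys y0 => P xs y0 * ∏ t : Fin n, Q (xs t) (prevState n y0 ys t) (ys t)

/-- `C_n(Q) = (1/n) max_{P_{X^n Y_0}} I(X^n; Y^n | Y_0)`. -/
def Cn {X Y : Type*} [Fintype X] [Fintype Y] (Q : X → Y → Y → ℝ) (n : ℕ) : ℝ :=
  sSup {r : ℝ | ∃ P : (Fin n → X) → Y → ℝ, IsJointPmfN n P ∧
    r = (1 / (n : ℝ)) * condMI (nLaw Q n P)}

/-- A pmf on a finite set. -/
def IsPmf {X : Type*} [Fintype X] (p : X → ℝ) : Prop :=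
  (∀ x, 0 ≤ p x) ∧ ∑ x : X, p x = 1

/-- The mutual information `I(X;Y)` across the memoryless channel `W` with input pmf `p`. -/
def mlMI {X Y : Type*} [Fintype X] [Fintype Y] (W : X → Y → ℝ) (p : X → ℝ) : ℝ :=
  ∑ x : X, ∑ y : Y, p x * W x y * Real.log (W x y / ∑ x' : X, p x' * W x' y)

/-- The conditional output kernel `P_{Y|Y'}(y|y') = ∑_x P_{X|Y'}(x|y') Q(y|x,y')`. -/
def condOut {X Y : Type*} [Fintype X] [Fintype Y]
    (Q : X → Y → Y → ℝ) (P : X → Y → ℝ) (y' y : Y) : ℝ :=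
  (∑ x : X, P x y' * Q x y' y) / (∑ x : X, P x y')

lemma condMI_aux {A B C : Type*} [Fintype A] [Fintype B] [Fintype C]
    (P : A → C → ℝ) (K : A → C → B → ℝ) (R : C → B → ℝ)
    (hP : ∀ a c, 0 ≤ P a c) (hK : ∀ a c b, 0 ≤ K a c b) (hK1 : ∀ a c, ∑ b, K a c b = 1)
    (hR : ∀ c b, 0 < R c b) (a : A) (b : B) (c : C) :
    P a c * K a c b *
      Real.log ((P a c * K a c b * ∑ a' : A, ∑ b' : B, P a' c * K a' c b') /
        ((∑ b' : B, P a c * K a c b') * (∑ a' : A, P a' c * K a' c b))) =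
    P a c * K a c b * Real.log (K a c b / R c b) -
    P a c * K a c b * Real.log ((∑ a' : A, P a' c * K a' c b) / ((∑ a', P a' c) * R c b)) := by
  have e1 : ∀ a', ∑ b' : B, P a' c * K a' c b' = P a' c := by
    intro a'; rw [← Finset.mul_sum, hK1, mul_one]
  simp only [e1]
  rcases (mul_nonneg (hP a c) (hK a c b)).eq_or_lt with h0 | h0
  · simp [← h0]
  have hPp : 0 < P a c := by
    rcases (hP a c).eq_or_lt with h | h
    · simp [← h] at h0
    · exact h
  have hKp : 0 < K a c b := by
    rcases (hK a c b).eq_or_lt with h | h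
    · simp [← h] at h0
    · exact h
  have hq : 0 < ∑ a' : A, P a' c * K a' c b :=
    lt_of_lt_of_le h0 (Finset.single_le_sum (f := fun a' => P a' c * K a' c b)
      (fun i _ => mul_nonneg (hP i c) (hK i c b)) (Finset.mem_univ a))
  have hpi : 0 < ∑ a' : A, P a' c :=
    lt_of_lt_of_le hPp (Finset.single_le_sum (f := fun a' => P a' c)
      (fun i _ => hP i c) (Finset.mem_univ a))
  have hRp := hR c b
  rw [← mul_sub, ← Real.log_div (by positivity) (by positivity)]
  congr 2
  field_simp

lemma condMI_le {A B C : Type*} [Fintype A] [Fintype B] [Fintype C]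
    (P : A → C → ℝ) (K : A → C → B → ℝ) (R : C → B → ℝ)
    (hP : ∀ a c, 0 ≤ P a c) (hK : ∀ a c b, 0 ≤ K a c b) (hK1 : ∀ a c, ∑ b, K a c b = 1)
    (hR : ∀ c b, 0 < R c b) (hR1 : ∀ c, ∑ b, R c b = 1) :
    condMI (fun a b c => P a c * K a c b) ≤
      ∑ a, ∑ c, P a c * ∑ b, K a c b * Real.log (K a c b / R c b) := by
  unfold condMI
  simp only [condMI_aux P K R hP hK hK1 hR, Finset.sum_sub_distrib]
  have h1 : ∑ a, ∑ b, ∑ c, P a c * K a c b * Real.log (K a c b / R c b) =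
      ∑ a, ∑ c, P a c * ∑ b, K a c b * Real.log (K a c b / R c b) := by
    refine Finset.sum_congr rfl fun a _ => ?_
    rw [Finset.sum_comm]
    refine Finset.sum_congr rfl fun c _ => ?_
    rw [Finset.mul_sum]
    refine Finset.sum_congr rfl fun b _ => ?_
    ring
  rw [h1]
  suffices h : 0 ≤ ∑ a, ∑ b, ∑ c, P a c * K a c b *
      Real.log ((∑ a' : A, P a' c * K a' c b) / ((∑ a', P a' c) * R c b)) by linarith
  have h2 : ∑ a, ∑ b, ∑ c, P a c * K a c b *
      Real.log ((∑ a' : A, P a' c * K a' c b) / ((∑ a', P a' c) * R c b)) =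
      ∑ c, ∑ b, (∑ a, P a c * K a c b) *
      Real.log ((∑ a' : A, P a' c * K a' c b) / ((∑ a', P a' c) * R c b)) := by
    conv_rhs => rw [Finset.sum_comm]
    rw [Finset.sum_comm]
    refine Finset.sum_congr rfl fun b _ => ?_
    rw [Finset.sum_comm]
    refine Finset.sum_congr rfl fun c _ => ?_
    rw [← Finset.sum_mul]
  rw [h2]
  refine Finset.sum_nonneg fun c _ => ?_
  have h3 : ∑ b, ((∑ a, P a c * K a c b) - (∑ a', P a' c) * R c b) = 0 := by
    rw [Finset.sum_sub_distrib, ← Finset.mul_sum, hR1, Finset.sum_comm]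
    simp_rw [← Finset.mul_sum, hK1]
    simp
  rw [← h3]
  refine Finset.sum_le_sum fun b _ => ?_
  have hq0 : 0 ≤ ∑ a, P a c * K a c b := Finset.sum_nonneg fun a _ => mul_nonneg (hP a c) (hK a c b)
  have hpi0 : 0 ≤ ∑ a, P a c := Finset.sum_nonneg fun a _ => hP a c
  have hRp := hR c b
  rcases hq0.eq_or_lt with h | h
  · rw [← h]; simp; positivity
  have hpi : 0 < ∑ a, P a c := by
    rcases hpi0.eq_or_lt with h' | h'
    · exfalso
      have := (Finset.sum_eq_zero_iff_of_nonneg (fun a _ => hP a c)).1 h'.symm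
      rw [Finset.sum_eq_zero] at h
      · exact lt_irrefl _ h
      · intro a ha; rw [this a ha, zero_mul]
    · exact h'
  have h4 := Real.one_sub_inv_le_log_of_pos (x := (∑ a' : A, P a' c * K a' c b) / ((∑ a', P a' c) * R c b)) (by positivity)
  have h5 := mul_le_mul_of_nonneg_left h4 h.le
  refine le_trans (le_of_eq ?_) h5
  field_simp

lemma condMI_eq {A B C : Type*} [Fintype A] [Fintype B] [Fintype C]
    (P : A → C → ℝ) (K : A → C → B → ℝ) (R : C → B → ℝ)
    (hP : ∀ a c, 0 ≤ P a c) (hK : ∀ a c b, 0 ≤ K a c b) (hK1 : ∀ a c, ∑ b, K a c b = 1)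
    (hR : ∀ c b, 0 < R c b)
    (hout : ∀ b c, ∑ a, P a c * K a c b = (∑ a, P a c) * R c b) :
    condMI (fun a b c => P a c * K a c b) =
      ∑ a, ∑ c, P a c * ∑ b, K a c b * Real.log (K a c b / R c b) := by
  unfold condMI
  simp only [condMI_aux P K R hP hK hK1 hR]
  refine Finset.sum_congr rfl fun a _ => ?_
  rw [Finset.sum_comm]
  refine Finset.sum_congr rfl fun c _ => ?_
  rw [Finset.mul_sum]
  refine Finset.sum_congr rfl fun b _ => ?_
  rw [hout]
  have : Real.log ((∑ a, P a c) * R c b / ((∑ a, P a c) * R c b)) = 0 := by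
    by_cases h : (∑ a, P a c) * R c b = 0
    · simp [h]
    · rw [div_self h, Real.log_one]
  rw [this]; ring

lemma sum_cons {Y : Type*} [Fintype Y] (n : ℕ) (F : (Fin (n+1) → Y) → ℝ) :
    ∑ f, F f = ∑ y, ∑ g : Fin n → Y, F (Fin.cons y g) := by
  rw [← Fintype.sum_prod_type']
  exact (Fintype.sum_equiv (Fin.consEquiv (fun _ : Fin (n+1) => Y)) _ _ (fun p => rfl)).symm

lemma prevState_zero {Y : Type*} (n : ℕ) (y0 : Y) (ys : Fin (n+1) → Y) :
    prevState (n+1) y0 ys 0 = y0 := by simp [prevState]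

lemma prevState_succ {Y : Type*} (n : ℕ) (y0 y : Y) (ys : Fin n → Y) (t : Fin n) :
    prevState (n+1) y0 (Fin.cons y ys) t.succ = prevState n y ys t := by
  obtain ⟨t, ht⟩ := t
  cases t with
  | zero => simp [prevState]
  | succ k =>
    simp only [prevState, Fin.succ_mk]
    simp
    rfl

/-- the path probability of the POST channel -/
def pathK {X Y : Type*} (Q : X → Y → Y → ℝ) (n : ℕ) (xs : Fin n → X) (y0 : Y)
    (ys : Fin n → Y) : ℝ := ∏ t : Fin n, Q (xs t) (prevState n y0 ys t) (ys t)

/-- the path probability of a Markov chain -/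
def pathR {Y : Type*} (R : Y → Y → ℝ) (n : ℕ) (y0 : Y)
    (ys : Fin n → Y) : ℝ := ∏ t : Fin n, R (prevState n y0 ys t) (ys t)

lemma pathK_cons {X Y : Type*} (Q : X → Y → Y → ℝ) (n : ℕ) (xs : Fin (n+1) → X) (y0 y : Y)
    (ys : Fin n → Y) : pathK Q (n+1) xs y0 (Fin.cons y ys) =
      Q (xs 0) y0 y * pathK Q n (Fin.tail xs) y ys := by
  unfold pathK
  rw [Fin.prod_univ_succ]
  simp only [prevState_zero, prevState_succ, Fin.cons_zero, Fin.cons_succ, Fin.tail]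

lemma pathR_cons {Y : Type*} (R : Y → Y → ℝ) (n : ℕ) (y0 y : Y)
    (ys : Fin n → Y) : pathR R (n+1) y0 (Fin.cons y ys) =
      R y0 y * pathR R n y ys := by
  unfold pathR
  rw [Fin.prod_univ_succ]
  simp only [prevState_zero, prevState_succ, Fin.cons_zero, Fin.cons_succ]

lemma pathK_nonneg {X Y : Type*} (Q : X → Y → Y → ℝ) (hQ : ∀ x y' y, 0 ≤ Q x y' y)
    (n : ℕ) (xs : Fin n → X) (y0 : Y)
    (ys : Fin n → Y) : 0 ≤ pathK Q n xs y0 ys := Finset.prod_nonneg fun _ _ => hQ _ _ _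

lemma pathR_pos {Y : Type*} (R : Y → Y → ℝ) (hR : ∀ y' y, 0 < R y' y)
    (n : ℕ) (y0 : Y)
    (ys : Fin n → Y) : 0 < pathR R n y0 ys := Finset.prod_pos fun _ _ => hR _ _

lemma pathK_sum {X Y : Type*} [Fintype Y] (Q : X → Y → Y → ℝ) (hQ : ∀ x y', ∑ y, Q x y' y = 1)
    (n : ℕ) : ∀ (xs : Fin n → X) (y0 : Y), ∑ ys, pathK Q n xs y0 ys = 1 := by
  induction n with
  | zero => intro xs y0; simp [pathK]
  | succ n ih =>
    intro xs y0
    rw [sum_cons]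
    simp_rw [pathK_cons, ← Finset.mul_sum, ih, mul_one, hQ]

lemma pathR_sum {Y : Type*} [Fintype Y] (R : Y → Y → ℝ) (hR : ∀ y', ∑ y, R y' y = 1)
    (n : ℕ) : ∀ (y0 : Y), ∑ ys, pathR R n y0 ys = 1 := by
  induction n with
  | zero => intro y0; simp [pathR]
  | succ n ih =>
    intro y0
    rw [sum_cons]
    simp_rw [pathR_cons, ← Finset.mul_sum, ih, mul_one, hR]

/-- divergence of a path law -/
def pathD {X Y : Type*} [Fintype Y] (Q : X → Y → Y → ℝ) (R : Y → Y → ℝ) (n : ℕ)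
    (xs : Fin n → X) (y0 : Y) : ℝ :=
  ∑ ys, pathK Q n xs y0 ys * Real.log (pathK Q n xs y0 ys / pathR R n y0 ys)

lemma pathD_succ {X Y : Type*} [Fintype Y] (Q : X → Y → Y → ℝ) (R : Y → Y → ℝ)
    (hQ0 : ∀ x y' y, 0 ≤ Q x y' y)
    (hQ : ∀ x y', ∑ y, Q x y' y = 1) (hR : ∀ y' y, 0 < R y' y) (n : ℕ)
    (xs : Fin (n+1) → X) (y0 : Y) : pathD Q R (n+1) xs y0 =
    ∑ y, Q (xs 0) y0 y * Real.log (Q (xs 0) y0 y / R y0 y) +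
    ∑ y, Q (xs 0) y0 y * pathD Q R n (Fin.tail xs) y := by
  unfold pathD
  rw [sum_cons, ← Finset.sum_add_distrib]
  refine Finset.sum_congr rfl fun y _ => ?_
  rw [← mul_add]
  have : Real.log (Q (xs 0) y0 y / R y0 y) =
      ∑ ys, pathK Q n (Fin.tail xs) y ys * Real.log (Q (xs 0) y0 y / R y0 y) := by
    rw [← Finset.sum_mul, pathK_sum Q hQ, one_mul]
  rw [this, ← Finset.sum_add_distrib, Finset.mul_sum]
  refine Finset.sum_congr rfl fun ys _ => ?_
  rw [pathK_cons, pathR_cons, mul_assoc, ← mul_add]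
  rcases (hQ0 (xs 0) y0 y).eq_or_lt with h | h
  · simp [← h]
  rcases (pathK_nonneg Q hQ0 n (Fin.tail xs) y ys).eq_or_lt with h' | h'
  · simp [← h']
  have h1 := hR y0 y
  have h2 := pathR_pos R hR n y ys
  rw [mul_div_mul_comm, Real.log_mul (by positivity) (by positivity)]

lemma pathD_le {X Y : Type*} [Fintype Y] (Q : X → Y → Y → ℝ) (R : Y → Y → ℝ)
    (hQ0 : ∀ x y' y, 0 ≤ Q x y' y)
    (hQ : ∀ x y', ∑ y, Q x y' y = 1) (hR : ∀ y' y, 0 < R y' y) (h : Y → ℝ) (l c : ℝ)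
    (hc : ∀ y, -c ≤ h y)
    (hk : ∀ x y', ∑ y, Q x y' y * Real.log (Q x y' y / R y' y) + ∑ y, Q x y' y * h y ≤ l + h y')
    (n : ℕ) : ∀ (xs : Fin n → X) (y0 : Y), pathD Q R n xs y0 ≤ n * l + h y0 + c := by
  induction n with
  | zero => intro xs y0; simp [pathD, pathK, pathR]; linarith [hc y0]
  | succ n ih =>
    intro xs y0
    rw [pathD_succ Q R hQ0 hQ hR]
    have h1 : ∑ y, Q (xs 0) y0 y * pathD Q R n (Fin.tail xs) y ≤
        ∑ y, Q (xs 0) y0 y * (n * l + h y + c) :=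
      Finset.sum_le_sum fun y _ => mul_le_mul_of_nonneg_left (ih _ _) (hQ0 _ _ _)
    have h2 : ∑ y, Q (xs 0) y0 y * (n * l + h y + c) = n * l + c + ∑ y, Q (xs 0) y0 y * h y := by
      have : ∀ y, Q (xs 0) y0 y * (n * l + h y + c) =
        Q (xs 0) y0 y * (n * l + c) + Q (xs 0) y0 y * h y := fun y => by ring
      simp_rw [this, Finset.sum_add_distrib, ← Finset.sum_mul, hQ]; ring
    have := hk (xs 0) y0
    push_cast
    linarith

lemma pathD_ge {X Y : Type*} [Fintype Y] (Q : X → Y → Y → ℝ) (R : Y → Y → ℝ)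
    (hQ0 : ∀ x y' y, 0 ≤ Q x y' y)
    (hQ : ∀ x y', ∑ y, Q x y' y = 1) (hR : ∀ y' y, 0 < R y' y) (h : Y → ℝ) (l c : ℝ)
    (S : Finset X)
    (hc : ∀ y, h y ≤ c)
    (hk : ∀ x ∈ S, ∀ y', ∑ y, Q x y' y * Real.log (Q x y' y / R y' y) + ∑ y, Q x y' y * h y
      = l + h y')
    (n : ℕ) : ∀ (xs : Fin n → X) (_ : ∀ t, xs t ∈ S) (y0 : Y),
      n * l + h y0 - c ≤ pathD Q R n xs y0 := by
  induction n with
  | zero => intro xs _ y0; simp [pathD, pathK, pathR]; linarith [hc y0]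
  | succ n ih =>
    intro xs hxs y0
    rw [pathD_succ Q R hQ0 hQ hR]
    have h1 : ∑ y, Q (xs 0) y0 y * (n * l + h y - c) ≤
        ∑ y, Q (xs 0) y0 y * pathD Q R n (Fin.tail xs) y :=
      Finset.sum_le_sum fun y _ => mul_le_mul_of_nonneg_left
        (ih _ (fun t => hxs _) _) (hQ0 _ _ _)
    have h2 : ∑ y, Q (xs 0) y0 y * (n * l + h y - c) = n * l - c + ∑ y, Q (xs 0) y0 y * h y := by
      have : ∀ y, Q (xs 0) y0 y * (n * l + h y - c) =
        Q (xs 0) y0 y * (n * l - c) + Q (xs 0) y0 y * h y := fun y => by ring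
      simp_rw [this, Finset.sum_add_distrib, ← Finset.sum_mul, hQ]; ring
    have := hk (xs 0) (hxs 0) y0
    push_cast
    linarith

/-- the (signed) input law obtained by inverting the channel -/
def inU {X Y : Type*} [Fintype Y] (B : X → Y → Y → ℝ) : (n : ℕ) → (Fin n → X) → Y → ℝ
  | 0, _, _ => 1
  | n + 1, xs, y0 => ∑ y, B (xs 0) y0 y * inU B n (Fin.tail xs) y

lemma inU_out {X Y : Type*} [Fintype X] [Fintype Y] [DecidableEq Y] (Q B : X → Y → Y → ℝ)
    (R : Y → Y → ℝ)
    (hB : ∀ y' z y, ∑ x, B x y' z * Q x y' y = if z = y then R y' y else 0) (n : ℕ) :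
    ∀ (y0 : Y) (ys : Fin n → Y), ∑ xs, inU B n xs y0 * pathK Q n xs y0 ys = pathR R n y0 ys := by
  induction n with
  | zero => intro y0 ys; simp [inU, pathK, pathR]
  | succ n ih =>
    intro y0 ys
    obtain ⟨y, ys, rfl⟩ : ∃ y ys', ys = Fin.cons y ys' := ⟨ys 0, Fin.tail ys, by simp⟩
    rw [sum_cons, pathR_cons, ← ih y ys, Finset.sum_comm, Finset.mul_sum]
    refine Finset.sum_congr rfl fun xs _ => ?_
    simp only [pathK_cons, inU, Fin.cons_zero, Fin.tail_cons]
    have : ∀ x, (∑ z, B x y0 z * inU B n xs z) * (Q x y0 y * pathK Q n xs y ys) =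
      ∑ z, (B x y0 z * Q x y0 y) * (inU B n xs z * pathK Q n xs y ys) := by
      intro x
      rw [Finset.sum_mul]
      refine Finset.sum_congr rfl fun z _ => ?_
      ring
    simp_rw [this]
    rw [Finset.sum_comm]
    simp_rw [← Finset.sum_mul, hB]
    simp

lemma inU_supp {X Y : Type*} [Fintype Y] (B : X → Y → Y → ℝ) (S : Finset X)
    (hBS : ∀ x, x ∉ S → ∀ y' y, B x y' y = 0) (n : ℕ) :
    ∀ (xs : Fin n → X) (y0 : Y), (¬ ∀ t, xs t ∈ S) → inU B n xs y0 = 0 := by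
  induction n with
  | zero => intro xs y0 h; exact absurd (fun t => t.elim0) h
  | succ n ih =>
    intro xs y0 h
    rw [inU]
    by_cases h0 : xs 0 ∈ S
    · refine Finset.sum_eq_zero fun y _ => ?_
      rw [ih, mul_zero]
      intro h'
      apply h
      intro t
      refine Fin.cases h0 (fun i => h' i) t
    · refine Finset.sum_eq_zero fun y _ => ?_
      rw [hBS _ h0, zero_mul]

lemma inU_cone {X Y : Type*} [Fintype Y] (B : X → Y → Y → ℝ) (b : X → Y → ℝ) (S : Finset X)
    (hBS : ∀ x, x ∉ S → ∀ y' y, B x y' y = 0) (p β η ε : ℝ) (hη : 0 < η) (hη1 : η ≤ 1)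
    (hp : 0 < p)
    (hb : ∀ x ∈ S, p ≤ ∑ y, b x y) (hβ : ∀ x ∈ S, ∑ y, |b x y| ≤ β)
    (hβη : β * η ≤ p / 2) (hε : ε * Fintype.card Y * 2 ≤ η * (p / 2))
    (hB : ∀ x ∈ S, ∀ y' y, |B x y' y - b x y| ≤ ε) (n : ℕ) :
    ∀ (xs : Fin n → X), ∃ c, 0 ≤ c ∧ ∀ y0, |inU B n xs y0 - c| ≤ η * c := by
  induction n with
  | zero => intro xs; exact ⟨1, zero_le_one, fun y0 => by simp [inU]; exact hη.le⟩
  | succ n ih =>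
    intro xs
    obtain ⟨c, hc, h⟩ := ih (Fin.tail xs)
    by_cases h0 : xs 0 ∈ S
    swap
    · refine ⟨0, le_rfl, fun y0 => ?_⟩
      rw [inU]
      simp [hBS _ h0]
    set v := inU B n (Fin.tail xs)
    have hlow : c * (p / 2) ≤ ∑ y, b (xs 0) y * v y := by
      have e : ∑ y, b (xs 0) y * v y = c * ∑ y, b (xs 0) y + ∑ y, b (xs 0) y * (v y - c) := by
        rw [Finset.mul_sum, ← Finset.sum_add_distrib]
        exact Finset.sum_congr rfl fun y _ => by ring
      have h1 : |∑ y, b (xs 0) y * (v y - c)| ≤ β * (η * c) := by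
        calc _ ≤ ∑ y, |b (xs 0) y * (v y - c)| := Finset.abs_sum_le_sum_abs _ _
          _ ≤ ∑ y, |b (xs 0) y| * (η * c) := Finset.sum_le_sum fun y _ => by
              rw [abs_mul]; exact mul_le_mul_of_nonneg_left (h y) (abs_nonneg _)
          _ = (∑ y, |b (xs 0) y|) * (η * c) := by rw [Finset.sum_mul]
          _ ≤ _ := mul_le_mul_of_nonneg_right (hβ _ h0) (by positivity)
      have h2 := (abs_le.1 h1).1
      have h3 : c * p ≤ c * ∑ y, b (xs 0) y := mul_le_mul_of_nonneg_left (hb _ h0) hc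
      have h4 : β * η * c ≤ p / 2 * c := mul_le_mul_of_nonneg_right hβη hc
      rw [e]; nlinarith
    refine ⟨∑ y, b (xs 0) y * v y, le_trans (by positivity) hlow, fun y0 => ?_⟩
    rw [inU, ← Finset.sum_sub_distrib]
    have hv : ∀ y, |v y| ≤ 2 * c := by
      intro y
      have := abs_le.1 (h y)
      have h5 : η * c ≤ 1 * c := mul_le_mul_of_nonneg_right hη1 hc
      rw [abs_le]; constructor <;> linarith [this.1, this.2]
    calc _ ≤ ∑ y, |B (xs 0) y0 y * v y - b (xs 0) y * v y| := Finset.abs_sum_le_sum_abs _ _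
      _ ≤ ∑ y : Y, ε * (2 * c) := Finset.sum_le_sum fun y _ => by
          rw [← sub_mul, abs_mul]
          exact mul_le_mul (hB _ h0 _ _) (hv y) (abs_nonneg _)
            (le_trans (abs_nonneg _) (hB _ h0 y y))
      _ = (ε * Fintype.card Y * 2) * c := by simp; ring
      _ ≤ η * (p / 2) * c := mul_le_mul_of_nonneg_right hε hc
      _ = η * (c * (p / 2)) := by ring
      _ ≤ _ := mul_le_mul_of_nonneg_left hlow hη.le

lemma inU_nonneg_of_cone {X Y : Type*} [Fintype Y] (B : X → Y → Y → ℝ) (η : ℝ) (hη1 : η ≤ 1)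
    (H : ∀ n (xs : Fin n → X), ∃ c, 0 ≤ c ∧ ∀ y0, |inU B n xs y0 - c| ≤ η * c)
    (n : ℕ) (xs : Fin n → X) (y0 : Y) : 0 ≤ inU B n xs y0 := by
  obtain ⟨c, hc, h⟩ := H n xs
  have := (abs_le.1 (h y0)).1
  have h5 : η * c ≤ 1 * c := mul_le_mul_of_nonneg_right hη1 hc
  linarith

lemma abstract_main {X Y : Type*} [Fintype X] [Fintype Y] [DecidableEq X] [DecidableEq Y]
    [Nonempty Y]
    (Q B : X → Y → Y → ℝ) (hQ : IsPOST Q) (S : Finset X) (R : Y → Y → ℝ)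
    (hR : ∀ y' y, 0 < R y' y) (hR1 : ∀ y', ∑ y, R y' y = 1) (h : Y → ℝ) (l : ℝ)
    (hk : ∀ x y', ∑ y, Q x y' y * Real.log (Q x y' y / R y' y) + ∑ y, Q x y' y * h y ≤ l + h y')
    (hk' : ∀ x ∈ S, ∀ y', ∑ y, Q x y' y * Real.log (Q x y' y / R y' y) + ∑ y, Q x y' y * h y
      = l + h y')
    (hB : ∀ y' z y, ∑ x, B x y' z * Q x y' y = if z = y then R y' y else 0)
    (hBS : ∀ x, x ∉ S → ∀ y' y, B x y' y = 0)
    (hu : ∀ n (xs : Fin n → X) y0, 0 ≤ inU B n xs y0)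
    (q : Y → ℝ) (hq : ∀ y, 0 ≤ q y) (hq1 : ∑ y, q y = 1)
    (hqR : ∀ y, ∑ y', q y' * R y' y = q y) :
    Filter.Tendsto (fun m : ℕ => Cn Q (m + 1)) Filter.atTop (nhds (Cfstar Q)) := by
  obtain ⟨hQ0, hQ1⟩ := hQ
  -- feedback functional equals l
  have hcf : Cfstar Q = l := by
    apply IsGreatest.csSup_eq
    constructor
    · have hp0 : ∀ x y', 0 ≤ ∑ y, B x y' y := by
        intro x y'
        simpa [inU] using hu 1 (fun _ => x) y'
      have hpo : ∀ y' y, ∑ x, (∑ z, B x y' z) * Q x y' y = R y' y := by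
        intro y' y
        simp_rw [Finset.sum_mul]
        rw [Finset.sum_comm]
        simp [hB]
      have hp1 : ∀ y', ∑ x, ∑ y, B x y' y = 1 := by
        intro y'
        rw [← hR1 y']
        simp_rw [← hpo y']
        conv_rhs => rw [Finset.sum_comm]
        simp_rw [← Finset.mul_sum, hQ1, mul_one]
      have hm : ∀ y', ∑ x, q y' * ∑ y, B x y' y = q y' := by
        intro y'; rw [← Finset.mul_sum, hp1, mul_one]
      refine ⟨fun x y' => q y' * ∑ y, B x y' y, ⟨fun x y => mul_nonneg (hq y) (hp0 x y), ?_⟩, ?_, ?_⟩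
      · rw [Finset.sum_comm]
        simp_rw [hm, hq1]
      · intro y
        rw [Finset.sum_comm]
        simp_rw [mul_assoc, ← Finset.mul_sum, hpo, hqR, hp1, mul_one]
      · unfold fbMI
        rw [condMI_eq (fun x y' => q y' * ∑ y, B x y' y) Q R (fun x y => mul_nonneg (hq y) (hp0 x y))
          hQ0 hQ1 hR]
        · have : ∀ x y', q y' * (∑ y, B x y' y) * ∑ y, Q x y' y * Real.log (Q x y' y / R y' y) =
            q y' * (∑ y, B x y' y) * (l + h y') -
            ∑ y, (q y' * ((∑ y, B x y' y) * Q x y' y)) * h y := by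
            intro x y'
            by_cases hx : x ∈ S
            · rw [← hk' x hx y', mul_add, Finset.mul_sum (f := fun y => Q x y' y * h y)]
              simp_rw [mul_assoc]; ring
            · simp [hBS x hx]
          simp_rw [this]
          simp_rw [Finset.sum_sub_distrib]
          rw [Finset.sum_comm]
          simp_rw [← Finset.sum_mul, hm]
          have e2 : ∑ x, ∑ y', ∑ y, (q y' * ((∑ y, B x y' y) * Q x y' y)) * h y = ∑ y, q y * h y := by
            calc _ = ∑ x, ∑ y, ∑ y', (q y' * ((∑ y, B x y' y) * Q x y' y)) * h y :=
                  Finset.sum_congr rfl fun x _ => Finset.sum_comm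
              _ = ∑ y, ∑ x, ∑ y', (q y' * ((∑ y, B x y' y) * Q x y' y)) * h y := Finset.sum_comm
              _ = ∑ y, ∑ y', ∑ x, (q y' * ((∑ y, B x y' y) * Q x y' y)) * h y :=
                  Finset.sum_congr rfl fun x _ => Finset.sum_comm
              _ = _ := by
                simp_rw [← Finset.sum_mul, ← Finset.mul_sum, hpo, hqR]
          rw [e2]
          simp_rw [mul_add, Finset.sum_add_distrib, ← Finset.sum_mul, hq1]
          ring
        · intro y y'
          rw [hm]
          simp_rw [mul_assoc, ← Finset.mul_sum, hpo]
    · rintro r ⟨P, ⟨hP0, hP1⟩, hPs, rfl⟩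
      refine le_trans (condMI_le P Q R hP0 hQ0 hQ1 hR hR1) ?_
      have h1 : ∀ x y', P x y' * ∑ y, Q x y' y * Real.log (Q x y' y / R y' y) ≤
          P x y' * l + (P x y' * h y' - ∑ y, P x y' * Q x y' y * h y) := by
        intro x y'
        have := mul_le_mul_of_nonneg_left (hk x y') (hP0 x y')
        rw [mul_add, mul_add, Finset.mul_sum (f := fun y => Q x y' y * h y)] at this
        simp_rw [mul_assoc]
        linarith
      refine le_trans (Finset.sum_le_sum fun x _ => Finset.sum_le_sum fun y' _ => h1 x y') ?_
      simp_rw [Finset.sum_add_distrib, Finset.sum_sub_distrib, ← Finset.sum_mul, hP1]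
      have e2 : ∑ x, ∑ y', ∑ y, P x y' * Q x y' y * h y = ∑ x, ∑ y', P x y' * h y' := by
        calc _ = ∑ x, ∑ y, ∑ y', P x y' * Q x y' y * h y :=
              Finset.sum_congr rfl fun x _ => Finset.sum_comm
          _ = ∑ y, ∑ x, ∑ y', P x y' * Q x y' y * h y := Finset.sum_comm
          _ = ∑ y, ∑ x, P x y * h y := by
              have hPs' : ∀ y, ∑ x, ∑ y', P x y' * Q x y' y = ∑ x, P x y := hPs
              simp_rw [← Finset.sum_mul, hPs']
          _ = _ := Finset.sum_comm
      rw [e2]; simp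
  rw [hcf]
  obtain ⟨c, hc⟩ : ∃ c : ℝ, ∀ y, |h y| ≤ c := by
    refine ⟨∑ y, |h y|, fun y => Finset.single_le_sum (f := fun y => |h y|)
      (fun _ _ => abs_nonneg _) (Finset.mem_univ y)⟩
  have hup : ∀ n : ℕ, 0 < n → ∀ r ∈ {r : ℝ | ∃ P : (Fin n → X) → Y → ℝ, IsJointPmfN n P ∧
    r = (1 / (n : ℝ)) * condMI (nLaw Q n P)}, r ≤ l + 2 * c / n := by
    rintro n hn r ⟨P, ⟨hP0, hP1⟩, rfl⟩
    have hn' : (0:ℝ) < n := by exact_mod_cast hn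
    have h1 : condMI (nLaw Q n P) ≤ n * l + 2 * c := by
      refine le_trans (condMI_le P (pathK Q n) (pathR R n) hP0 (pathK_nonneg Q hQ0 n)
        (pathK_sum Q hQ1 n) (pathR_pos R hR n) (pathR_sum R hR1 n)) ?_
      calc _ ≤ ∑ xs, ∑ y0, P xs y0 * (n * l + 2 * c) := by
            refine Finset.sum_le_sum fun xs _ => Finset.sum_le_sum fun y0 _ =>
              mul_le_mul_of_nonneg_left ?_ (hP0 _ _)
            have := pathD_le Q R hQ0 hQ1 hR h l c (fun y => (abs_le.1 (hc y)).1) hk n xs y0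
            have h2 := (abs_le.1 (hc y0)).2
            unfold pathD at this
            linarith
        _ = _ := by simp_rw [← Finset.sum_mul, hP1, one_mul]
    calc 1 / (n:ℝ) * condMI (nLaw Q n P) ≤ 1 / (n:ℝ) * (n * l + 2 * c) :=
          mul_le_mul_of_nonneg_left h1 (by positivity)
      _ = _ := by field_simp
  have hlo : ∀ n : ℕ, 0 < n → ∃ r ∈ {r : ℝ | ∃ P : (Fin n → X) → Y → ℝ, IsJointPmfN n P ∧
    r = (1 / (n : ℝ)) * condMI (nLaw Q n P)}, l - 2 * c / n ≤ r := by
    intro n hn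
    have hn' : (0:ℝ) < n := by exact_mod_cast hn
    have hs : ∀ y0, ∑ xs, inU B n xs y0 = 1 := by
      intro y0
      rw [← pathR_sum R hR1 n y0]
      simp_rw [← inU_out Q B R hB n y0]
      rw [Finset.sum_comm]
      simp_rw [← Finset.mul_sum, pathK_sum Q hQ1, mul_one]
    have hm : ∀ y0, ∑ xs, q y0 * inU B n xs y0 = q y0 := by
      intro y'; rw [← Finset.mul_sum, hs, mul_one]
    have hP0 : ∀ (xs : Fin n → X) y0, 0 ≤ q y0 * inU B n xs y0 := fun xs y0 =>
      mul_nonneg (hq y0) (hu n xs y0)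
    have hP1 : ∑ xs : Fin n → X, ∑ y0, q y0 * inU B n xs y0 = 1 := by
      rw [Finset.sum_comm]; simp_rw [hm, hq1]
    refine ⟨_, ⟨fun xs y0 => q y0 * inU B n xs y0, ⟨hP0, hP1⟩, rfl⟩, ?_⟩
    have h1 : n * l - 2 * c ≤ condMI (nLaw Q n (fun xs y0 => q y0 * inU B n xs y0)) := by
      have := condMI_eq (fun (xs : Fin n → X) y0 => q y0 * inU B n xs y0)
        (pathK Q n) (pathR R n) hP0 (pathK_nonneg Q hQ0 n)
        (pathK_sum Q hQ1 n) (pathR_pos R hR n) (by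
          intro ys y0
          rw [hm]
          simp_rw [mul_assoc, ← Finset.mul_sum, inU_out Q B R hB n y0])
      refine le_trans ?_ this.ge
      calc n * l - 2 * c = ∑ xs : Fin n → X, ∑ y0, q y0 * inU B n xs y0 * (n * l - 2 * c) := by
            simp_rw [← Finset.sum_mul, hP1, one_mul]
        _ ≤ _ := by
            refine Finset.sum_le_sum fun xs _ => Finset.sum_le_sum fun y0 _ => ?_
            by_cases hx : ∀ t, xs t ∈ S
            · refine mul_le_mul_of_nonneg_left ?_ (hP0 _ _)
              have := pathD_ge Q R hQ0 hQ1 hR h l c S (fun y => (abs_le.1 (hc y)).2) hk' n xs hx y0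
              have h2 := (abs_le.1 (hc y0)).1
              unfold pathD at this
              linarith
            · rw [inU_supp B S hBS n xs y0 hx]; simp
    calc _ = 1 / (n:ℝ) * (n * l - 2 * c) := by field_simp
      _ ≤ _ := mul_le_mul_of_nonneg_left h1 (by positivity)
  have hbd : ∀ m : ℕ, |Cn Q (m + 1) - l| ≤ 2 * c / ((m : ℝ) + 1) := by
    intro m
    have h1 := hup (m + 1) (Nat.succ_pos m)
    obtain ⟨r, hr, hr'⟩ := hlo (m + 1) (Nat.succ_pos m)
    have h2 : Cn Q (m + 1) ≤ l + 2 * c / ((m + 1 : ℕ) : ℝ) := csSup_le ⟨r, hr⟩ h1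
    have h3 : r ≤ Cn Q (m + 1) := le_csSup ⟨_, h1⟩ hr
    push_cast at h2 hr'
    rw [abs_le]; constructor <;> linarith
  rw [tendsto_iff_dist_tendsto_zero]
  refine squeeze_zero (fun _ => dist_nonneg) (fun m => ?_)
    (g := fun m : ℕ => 2 * c * (1 / ((m : ℝ) + 1))) ?_
  · rw [Real.dist_eq]
    refine (hbd m).trans (le_of_eq ?_)
    ring
  · simpa using (tendsto_one_div_add_atTop_nhds_zero_nat (𝕜 := ℝ)).const_mul (2 * c)

lemma perron {Y : Type*} [Fintype Y] [Nonempty Y] (M : Y → Y → ℝ) (hM : ∀ i j, 0 < M i j) :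
    ∃ (v : Y → ℝ) (r : ℝ), 0 < r ∧ (∀ i, 0 < v i) ∧ ∑ i, v i = 1 ∧
      ∀ i, ∑ j, M i j * v j = r * v i := by
  classical
  -- compact set of pairs
  have hMn : ∀ i j, 0 ≤ M i j := fun i j => (hM i j).le
  set K : Set (ℝ × (Y → ℝ)) := (Set.Icc 0 (∑ i, ∑ j, M i j) ×ˢ stdSimplex ℝ Y) ∩
    {p | ∀ i, p.1 * p.2 i ≤ ∑ j, M i j * p.2 j} with hK
  have hKc : IsCompact K := by
    refine (isCompact_Icc.prod (isCompact_stdSimplex ℝ Y)).inter_right ?_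
    simp only [Set.ofPred_forall]
    refine isClosed_iInter fun i => isClosed_le (by fun_prop) (by fun_prop)
  have hKne : K.Nonempty := by
    obtain ⟨i0⟩ := ‹Nonempty Y›
    refine ⟨(0, Pi.single i0 1), ⟨⟨⟨le_rfl, ?_⟩, single_mem_stdSimplex ℝ i0⟩, ?_⟩⟩
    · exact Finset.sum_nonneg fun i _ => Finset.sum_nonneg fun j _ => hMn i j
    · intro i
      simp only [zero_mul]
      refine Finset.sum_nonneg fun j _ => mul_nonneg (hMn i j) ?_
      exact (single_mem_stdSimplex ℝ i0).1 j
  obtain ⟨⟨r, v⟩, ⟨⟨⟨hr0, hr1⟩, ⟨hv0, hv1⟩⟩, hv⟩, hmax⟩ :=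
    hKc.exists_isMaxOn hKne (continuous_fst.continuousOn)
  simp only at hr0 hr1 hv0 hv1
  have hv : ∀ i, r * v i ≤ ∑ j, M i j * v j := hv
  have hstrict : ∀ (u : Y → ℝ), (∀ i, 0 ≤ u i) → (∃ i, 0 < u i) → ∀ i, 0 < ∑ j, M i j * u j := by
    rintro u hu ⟨k, hk⟩ i
    exact Finset.sum_pos' (fun j _ => mul_nonneg (hMn i j) (hu j)) ⟨k, Finset.mem_univ k,
      mul_pos (hM i k) hk⟩
  have hvex : ∃ i, 0 < v i := by
    by_contra hcon
    push Not at hcon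
    have : ∑ i, v i ≤ 0 := Finset.sum_nonpos fun i _ => hcon i
    linarith
  set w : Y → ℝ := fun i => ∑ j, M i j * v j with hw
  have hwpos : ∀ i, 0 < w i := hstrict v hv0 hvex
  have heq : ∀ i, w i = r * v i := by
    by_contra hcon
    push Not at hcon
    obtain ⟨k, hk⟩ := hcon
    have hd : ∀ i, 0 < ∑ j, M i j * (w j - r * v j) :=
      hstrict _ (fun i => sub_nonneg.2 (hv i)) ⟨k, sub_pos.2 (lt_of_le_of_ne (hv k) (Ne.symm hk))⟩
    have hd' : ∀ i, r * w i < ∑ j, M i j * w j := by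
      intro i
      have := hd i
      have e : ∑ j, M i j * (w j - r * v j) = ∑ j, M i j * w j - r * w i := by
        simp only [hw]
        rw [Finset.mul_sum, ← Finset.sum_sub_distrib]
        exact Finset.sum_congr rfl fun j _ => by ring
      linarith
    obtain ⟨i1, _, hi1⟩ := Finset.exists_min_image Finset.univ
      (fun i => (∑ j, M i j * w j) / w i) Finset.univ_nonempty
    set r' := (∑ j, M i1 j * w j) / w i1 with hr'
    have hrr : r < r' := by rw [hr', lt_div_iff₀ (hwpos i1)]; exact hd' i1
    have hws : 0 < ∑ i, w i := Finset.sum_pos (fun i _ => hwpos i) Finset.univ_nonempty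
    have hr'w : ∀ i, r' * w i ≤ ∑ j, M i j * w j := by
      intro i
      rw [← le_div_iff₀ (hwpos i)]
      exact hi1 i (Finset.mem_univ i)
    have hmem : (r', fun i => w i / ∑ i, w i) ∈ K := by
      refine ⟨⟨⟨(hr0.trans hrr.le), ?_⟩, ⟨fun i => (div_pos (hwpos i) hws).le, ?_⟩⟩, ?_⟩
      · show r' ≤ _
        have h1 : r' * ∑ i, w i ≤ (∑ i, ∑ j, M i j) * ∑ i, w i := by
          rw [Finset.mul_sum, Finset.sum_mul]
          refine Finset.sum_le_sum fun i _ => (hr'w i).trans ?_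
          rw [Finset.sum_mul]
          refine Finset.sum_le_sum fun j _ => mul_le_mul_of_nonneg_left ?_ (hMn i j)
          exact Finset.single_le_sum (f := w) (fun i _ => (hwpos i).le) (Finset.mem_univ j)
        exact le_of_mul_le_mul_right h1 hws
      · rw [← Finset.sum_div, div_self hws.ne']
      · intro i
        show r' * (w i / ∑ i, w i) ≤ ∑ j, M i j * (w j / ∑ i, w i)
        simp_rw [← mul_div_assoc, ← Finset.sum_div]
        exact div_le_div_of_nonneg_right (hr'w i) hws.le
    have : r' ≤ r := hmax hmem
    linarith
  have hrpos : 0 < r := by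
    obtain ⟨k, hk⟩ := hvex
    have h1 := hwpos k
    rw [heq k] at h1
    exact (pos_iff_pos_of_mul_pos h1).2 hk
  refine ⟨v, r, hrpos, fun i => ?_, hv1, heq⟩
  have h1 := hwpos i
  rw [heq i] at h1
  exact (pos_iff_pos_of_mul_pos h1).1 hrpos

lemma perron_near {Y : Type*} [Fintype Y] [Nonempty Y] (M : Y → Y → ℝ) (hM : ∀ i j, 0 < M i j)
    (ε : ℝ) (hMε : ∀ i k j, |M i j - M k j| ≤ ε * M k j) :
    ∃ (v : Y → ℝ) (r : ℝ), 0 < r ∧ (∀ i, 0 < v i) ∧ (∀ i, |v i - 1| ≤ ε) ∧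
      ∀ i, ∑ j, M i j * v j = r * v i := by
  obtain ⟨v, r, hr, hv, -, he⟩ := perron M hM
  obtain ⟨k⟩ := ‹Nonempty Y›
  have hvk := hv k
  refine ⟨fun i => v i / v k, r, hr, fun i => div_pos (hv i) hvk, fun i => ?_, fun i => ?_⟩
  · have h1 : |v i - v k| ≤ ε * v k := by
      have h2 : r * |v i - v k| ≤ r * (ε * v k) := by
        calc r * |v i - v k| = |∑ j, (M i j - M k j) * v j| := by
              simp_rw [sub_mul, Finset.sum_sub_distrib, he]
              rw [← mul_sub, abs_mul, abs_of_pos hr]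
          _ ≤ ∑ j, |(M i j - M k j) * v j| := Finset.abs_sum_le_sum_abs _ _
          _ ≤ ∑ j, ε * (M k j * v j) := Finset.sum_le_sum fun j _ => by
              rw [abs_mul, abs_of_pos (hv j), ← mul_assoc]
              exact mul_le_mul_of_nonneg_right (hMε i k j) (hv j).le
          _ = _ := by rw [← Finset.mul_sum, he]; ring
      exact le_of_mul_le_mul_left h2 hr
    have : v i / v k - 1 = (v i - v k) / v k := by field_simp
    rw [this, abs_div, abs_of_pos hvk, div_le_iff₀ hvk]
    exact h1
  · simp_rw [← mul_div_assoc, ← Finset.sum_div, he]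

lemma stationary_exists {Y : Type*} [Fintype Y] [Nonempty Y] (R : Y → Y → ℝ)
    (hR : ∀ y' y, 0 < R y' y) (hR1 : ∀ y', ∑ y, R y' y = 1) :
    ∃ q : Y → ℝ, (∀ y, 0 ≤ q y) ∧ ∑ y, q y = 1 ∧ ∀ y, ∑ y', q y' * R y' y = q y := by
  obtain ⟨v, r, hr, hv, hv1, he⟩ := perron (fun i j => R j i) (fun i j => hR j i)
  refine ⟨v, fun y => (hv y).le, hv1, fun y => ?_⟩
  have hr1 : r = 1 := by
    have h1 : ∑ i, ∑ j, R j i * v j = ∑ i, r * v i := Finset.sum_congr rfl fun i _ => he i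
    rw [Finset.sum_comm, ← Finset.mul_sum, hv1] at h1
    simp_rw [← Finset.sum_mul, hR1, one_mul, hv1] at h1
    linarith
  have := he y
  rw [hr1, one_mul] at this
  rw [← this]
  exact Finset.sum_congr rfl fun _ _ => mul_comm _ _

/-- the square submatrix of the channel at a given previous output -/
def Vm {X Y : Type*} (e : Y → X) (Q : X → Y → Y → ℝ) (y' : Y) : Matrix Y Y ℝ :=
  fun i y => Q (e i) y' y

/-- solution of the linear equation `V g = H` -/
def gF {X Y : Type*} [Fintype Y] [DecidableEq Y] (e : Y → X) (Q : X → Y → Y → ℝ) (y' : Y) :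
    Y → ℝ :=
  Matrix.mulVec (Vm e Q y')⁻¹ (fun i => ∑ y, Real.negMulLog (Q (e i) y' y))

/-- the positive matrix whose Perron vector solves the Bellman equation -/
def Mm {X Y : Type*} [Fintype Y] [DecidableEq Y] (e : Y → X) (Q : X → Y → Y → ℝ) (y' y : Y) :
    ℝ := Real.exp (-(gF e Q y' y))

/-- the optimal output kernel -/
def Rm {X Y : Type*} [Fintype Y] [DecidableEq Y] (e : Y → X) (Q : X → Y → Y → ℝ) (v : Y → ℝ)
    (y' y : Y) : ℝ := Mm e Q y' y * v y / ∑ z, Mm e Q y' z * v z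

/-- matrices generating the input law -/
def Bm {X Y : Type*} [Fintype Y] [DecidableEq X] [DecidableEq Y] (e : Y → X)
    (Q : X → Y → Y → ℝ) (v : Y → ℝ)
    (x : X) (y' y : Y) : ℝ := ∑ i, if e i = x then (Vm e Q y')⁻¹ y i * Rm e Q v y' y else 0

lemma final_det {X Y : Type*} [Fintype X] [Fintype Y] [DecidableEq X] [DecidableEq Y]
    [Nonempty Y] (e : Y → X) (Q : X → Y → Y → ℝ) (hQ : IsPOST Q)
    (S : Finset X) (hS : ∀ x, x ∈ S ↔ ∃ i, e i = x)
    (hdet : ∀ y', IsUnit (Vm e Q y').det)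
    (hkkt : ∀ x, x ∉ S → ∀ y', ∑ y, Q x y' y * gF e Q y' y < ∑ y, Real.negMulLog (Q x y' y))
    (v : Y → ℝ) (r : ℝ) (hr : 0 < r) (hv : ∀ i, 0 < v i)
    (hMv : ∀ i, ∑ j, Mm e Q i j * v j = r * v i)
    (hu : ∀ n (xs : Fin n → X) y0, 0 ≤ inU (Bm e Q v) n xs y0) :
    Filter.Tendsto (fun m : ℕ => Cn Q (m + 1)) Filter.atTop (nhds (Cfstar Q)) := by
  have hM : ∀ i j, 0 < Mm e Q i j := fun i j => Real.exp_pos _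
  have hRe : ∀ y' y, Rm e Q v y' y = Mm e Q y' y * v y / (r * v y') := by
    intro y' y; rw [Rm, hMv]
  have hR : ∀ y' y, 0 < Rm e Q v y' y := by
    intro y' y; rw [hRe]
    exact div_pos (mul_pos (hM _ _) (hv _)) (mul_pos hr (hv _))
  have hR1 : ∀ y', ∑ y, Rm e Q v y' y = 1 := by
    intro y'
    simp_rw [hRe, ← Finset.sum_div, hMv]
    exact div_self (mul_pos hr (hv _)).ne'
  obtain ⟨q, hq, hq1, hqR⟩ := stationary_exists _ hR hR1
  have hid : ∀ x y', ∑ y, Q x y' y * Real.log (Q x y' y / Rm e Q v y' y) +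
      ∑ y, Q x y' y * Real.log (v y) =
      Real.log r + Real.log (v y') +
        (∑ y, Q x y' y * gF e Q y' y - ∑ y, Real.negMulLog (Q x y' y)) := by
    intro x y'
    have h1 : ∀ y, Q x y' y * Real.log (Q x y' y / Rm e Q v y' y) + Q x y' y * Real.log (v y) =
        Q x y' y * (Real.log r + Real.log (v y')) +
        (Q x y' y * gF e Q y' y - Real.negMulLog (Q x y' y)) := by
      intro y
      by_cases h0 : Q x y' y = 0
      · simp [h0]
      rw [Real.log_div h0 (hR _ _).ne', hRe, Real.log_div (mul_pos (hM _ _) (hv _)).ne'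
        (mul_pos hr (hv _)).ne', Real.log_mul (hM _ _).ne' (hv _).ne',
        Real.log_mul hr.ne' (hv _).ne', Mm, Real.log_exp, Real.negMulLog]
      ring
    rw [← Finset.sum_add_distrib]
    simp_rw [h1, Finset.sum_add_distrib, Finset.sum_sub_distrib, ← Finset.sum_mul, hQ.2]
    ring
  have hS' : ∀ x ∈ S, ∀ y', ∑ y, Q x y' y * gF e Q y' y = ∑ y, Real.negMulLog (Q x y' y) := by
    intro x hx y'
    obtain ⟨i, rfl⟩ := (hS x).1 hx
    have h1 : Matrix.mulVec (Vm e Q y') (gF e Q y') =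
        fun i => ∑ y, Real.negMulLog (Q (e i) y' y) := by
      rw [gF, Matrix.mulVec_mulVec, Matrix.mul_nonsing_inv _ (hdet y'), Matrix.one_mulVec]
    exact congrFun h1 i
  refine abstract_main Q (Bm e Q v) hQ S (Rm e Q v) hR hR1 (fun y => Real.log (v y)) (Real.log r)
    ?_ ?_ ?_ ?_ hu q hq hq1 hqR
  · intro x y'
    simp only [hid]
    by_cases hx : x ∈ S
    · rw [hS' x hx]; simp
    · linarith [hkkt x hx y']
  · intro x hx y'
    simp only [hid]
    rw [hS' x hx]; simp
  · intro y' z y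
    have h1 : ∑ x, Bm e Q v x y' z * Q x y' y =
        (∑ i, (Vm e Q y')⁻¹ z i * Vm e Q y' i y) * Rm e Q v y' z := by
      simp_rw [Bm, Finset.sum_mul]
      rw [Finset.sum_comm]
      refine Finset.sum_congr rfl fun i _ => ?_
      simp only [ite_mul, zero_mul, Finset.sum_ite_eq, Finset.mem_univ, if_true, Vm]
      ring
    have h2 : ∑ i, (Vm e Q y')⁻¹ z i * Vm e Q y' i y = (1 : Matrix Y Y ℝ) z y := by
      rw [← Matrix.nonsing_inv_mul _ (hdet y'), Matrix.mul_apply]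
    rw [h1, h2, Matrix.one_apply]
    split_ifs with h
    · rw [h, one_mul]
    · rw [zero_mul]
  · intro x hx y' y
    refine Finset.sum_eq_zero fun i _ => if_neg ?_
    intro h
    exact hx ((hS x).2 ⟨i, h⟩)

lemma cont_Vinv {X Y : Type*} [Fintype X] [Fintype Y] [DecidableEq Y] (e : Y → X)
    (Q0 : X → Y → Y → ℝ) (y' : Y) (hdet : IsUnit (Vm e Q0 y').det) :
    ContinuousAt (fun Q : X → Y → Y → ℝ => (Vm e Q y')⁻¹) Q0 := by
  have h1 : ContinuousAt (fun Q : X → Y → Y → ℝ => Vm e Q y') Q0 := by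
    apply Continuous.continuousAt
    unfold Vm
    exact continuous_pi fun i => continuous_pi fun j => by fun_prop
  refine ContinuousAt.comp (f := fun Q : X → Y → Y → ℝ => Vm e Q y') (g := fun A => A⁻¹) ?_ h1
  refine continuousAt_matrix_inv _ ?_
  exact NormedRing.inverse_continuousAt hdet.unit

lemma cont_gF {X Y : Type*} [Fintype X] [Fintype Y] [DecidableEq Y] (e : Y → X)
    (Q0 : X → Y → Y → ℝ) (y' y : Y) (hdet : IsUnit (Vm e Q0 y').det) :
    ContinuousAt (fun Q : X → Y → Y → ℝ => gF e Q y' y) Q0 := by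
  unfold gF Matrix.mulVec dotProduct
  refine tendsto_finsetSum _ fun i _ => ?_
  refine ContinuousAt.mul ?_ ?_
  · have := cont_Vinv e Q0 y' hdet
    exact continuousAt_pi.1 (continuousAt_pi.1 this y) i
  · apply Continuous.continuousAt
    refine continuous_finsetSum _ fun z _ => ?_
    exact Real.continuous_negMulLog.comp (by fun_prop)

lemma cont_Bm {X Y : Type*} [Fintype X] [Fintype Y] [DecidableEq X] [DecidableEq Y] [Nonempty Y]
    (e : Y → X) (Q0 : X → Y → Y → ℝ) (x : X) (y' y : Y) (hdet : IsUnit (Vm e Q0 y').det) :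
    ContinuousAt (fun p : (X → Y → Y → ℝ) × (Y → ℝ) => Bm e p.1 p.2 x y' y) (Q0, 1) := by
  have hM : ∀ z, ContinuousAt (fun p : (X → Y → Y → ℝ) × (Y → ℝ) => Mm e p.1 y' z * p.2 z)
      (Q0, 1) := by
    intro z
    refine ContinuousAt.mul ?_ (by fun_prop)
    unfold Mm
    refine Real.continuous_exp.continuousAt.comp (ContinuousAt.neg ?_)
    exact ContinuousAt.comp (f := Prod.fst) (g := fun Q => gF e Q y' z) (cont_gF e Q0 y' z hdet)
      continuousAt_fst
  have hR : ContinuousAt (fun p : (X → Y → Y → ℝ) × (Y → ℝ) => Rm e p.1 p.2 y' y) (Q0, 1) := by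
    unfold Rm
    refine ContinuousAt.div (hM y) (tendsto_finsetSum _ fun z _ => hM z) ?_
    apply ne_of_gt
    refine Finset.sum_pos (fun z _ => ?_) Finset.univ_nonempty
    simp [Mm, Real.exp_pos]
  unfold Bm
  refine tendsto_finsetSum _ fun i _ => ?_
  by_cases h : e i = x
  · simp only [h, if_true]
    refine ContinuousAt.mul ?_ hR
    refine ContinuousAt.comp (f := Prod.fst) (g := fun Q => (Vm e Q y')⁻¹ y i) ?_ continuousAt_fst
    exact continuousAt_pi.1 (continuousAt_pi.1 (cont_Vinv e Q0 y' hdet) y) i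
  · simp only [h, if_false]
    exact tendsto_const_nhds

/-- For a memoryless surjective channel `W`, there is `δ > 0` such that
for every `W`-centered `δ`-approximately memoryless POST channel `Q`, the non-feedback
capacity functional `lim_{n→∞} C_n(Q)` equals the feedback capacity functional `C*_f(Q)`. -/
theorem feedback_does_not_increase_capacity
    {X Y : Type*} [Fintype X] [Fintype Y] [DecidableEq X] [DecidableEq Y]
    (hX : 2 ≤ Fintype.card X) (hY : 2 ≤ Fintype.card Y)
    (W : X → Y → ℝ) (hW0 : ∀ x y, 0 ≤ W x y) (hW1 : ∀ x, ∑ y : Y, W x y = 1)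
    -- `pX` is a capacity-achieving input distribution of `W`
    (pX : X → ℝ) (hpX : IsPmf pX)
    (hpXopt : ∀ p : X → ℝ, IsPmf p → mlMI W p ≤ mlMI W pX)
    -- surjectivity of `W`, witnessed by `S ⊆ 𝒳` with `|S| = |𝒴|`
    (S : Finset X) (hScard : S.card = Fintype.card Y)
    (hSpos : ∀ x ∈ S, 0 < pX x)
    (hSeq : ∀ x ∈ S,
      ∑ y : Y, W x y * Real.log (W x y / ∑ x' : X, pX x' * W x' y) = mlMI W pX)
    (hSlt : ∀ x ∉ S,
      ∑ y : Y, W x y * Real.log (W x y / ∑ x' : X, pX x' * W x' y) < mlMI W pX)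
    (hSrank : LinearIndependent ℝ (fun x : S => W x.val)) :
    ∃ δ > (0 : ℝ), ∀ Q : X → Y → Y → ℝ, IsPOST Q →
      (∀ x y' y, |Q x y' y - W x y| ≤ δ) →
      Filter.Tendsto (fun m : ℕ => Cn Q (m + 1)) Filter.atTop (nhds (Cfstar Q)) := by
  classical
  have hYne : Nonempty Y := Fintype.card_pos_iff.1 (by omega)
  set pY : Y → ℝ := fun y => ∑ x' : X, pX x' * W x' y with hpY
  set C := mlMI W pX with hC
  set D : X → ℝ := fun x => ∑ y : Y, W x y * Real.log (W x y / pY y) with hD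
  have hSeq : ∀ x ∈ S, D x = C := hSeq
  have hSlt : ∀ x ∉ S, D x < C := hSlt
  have hCD : C = ∑ x, pX x * D x := by
    simp only [hC, mlMI, hD, Finset.mul_sum, mul_assoc, hpY]
  -- support
  have hsupp : ∀ x, x ∉ S → pX x = 0 := by
    have h1 : ∑ x, pX x * (C - D x) = 0 := by
      simp_rw [mul_sub, Finset.sum_sub_distrib, ← Finset.sum_mul, hpX.2]
      linarith
    have h2 : ∀ x ∈ Finset.univ, 0 ≤ pX x * (C - D x) := by
      intro x _
      refine mul_nonneg (hpX.1 x) ?_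
      by_cases hx : x ∈ S
      · rw [hSeq x hx]; simp
      · linarith [hSlt x hx]
    intro x hx
    have h3 := (Finset.sum_eq_zero_iff_of_nonneg h2).1 h1 x (Finset.mem_univ x)
    rcases mul_eq_zero.1 h3 with h | h
    · exact h
    · linarith [hSlt x hx]
  -- indexing
  have hcard : Fintype.card Y = Fintype.card S := by rw [Fintype.card_coe, hScard]
  obtain ⟨e0⟩ : Nonempty (Y ≃ S) := Fintype.card_eq.1 hcard
  set e : Y → X := fun i => (e0 i : X) with he
  have heinj : Function.Injective e := Subtype.val_injective.comp e0.injective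
  have heS : ∀ i, e i ∈ S := fun i => (e0 i).2
  have hS : ∀ x, x ∈ S ↔ ∃ i, e i = x := by
    intro x
    constructor
    · intro hx; exact ⟨e0.symm ⟨x, hx⟩, by simp [he]⟩
    · rintro ⟨i, rfl⟩; exact heS i
  have hsumS : ∀ f : X → ℝ, (∀ x, x ∉ S → f x = 0) → ∑ x, f x = ∑ i, f (e i) := by
    intro f hf
    rw [← Finset.sum_subset (Finset.subset_univ S) (fun x _ hx => hf x hx), ← Finset.sum_coe_sort]
    exact (Fintype.sum_equiv e0 _ _ (fun i => rfl)).symm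
  set Q0 : X → Y → Y → ℝ := fun x _ y => W x y with hQ0
  have hdet0 : ∀ y', IsUnit (Vm e Q0 y').det := by
    intro y'
    rw [← Matrix.isUnit_iff_isUnit_det, ← Matrix.linearIndependent_rows_iff_isUnit]
    exact hSrank.comp e0 e0.injective
  have hpYnn : ∀ y, 0 ≤ pY y := fun y => Finset.sum_nonneg fun x _ => mul_nonneg (hpX.1 x) (hW0 x y)
  have hpYpos : ∀ y, 0 < pY y := by
    intro y
    rcases (hpYnn y).eq_or_lt with h | h
    · exfalso
      have h1 := (Finset.sum_eq_zero_iff_of_nonneg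
        (fun x _ => mul_nonneg (hpX.1 x) (hW0 x y))).1 h.symm
      have h2 : (Vm e Q0 y).det = 0 := by
        refine Matrix.det_eq_zero_of_column_eq_zero y fun i => ?_
        have := h1 (e i) (Finset.mem_univ _)
        exact (mul_eq_zero.1 this).resolve_left (hSpos _ (heS i)).ne'
      have := hdet0 y
      rw [h2] at this
      simp at this
    · exact h
  have hpY1 : ∑ y, pY y = 1 := by
    simp only [hpY]
    rw [Finset.sum_comm]
    simp_rw [← Finset.mul_sum, hW1, mul_one, hpX.2]
  set gW : Y → ℝ := fun y => -Real.log (pY y) - C with hgW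
  have hWg : ∀ x, ∑ y, W x y * gW y = ∑ y, Real.negMulLog (W x y) + (D x - C) := by
    intro x
    have h1 : ∀ y, W x y * gW y = Real.negMulLog (W x y) +
        (W x y * Real.log (W x y / pY y) - W x y * C) := by
      intro y
      by_cases h0 : W x y = 0
      · simp [h0]
      rw [Real.log_div h0 (hpYpos y).ne', Real.negMulLog, hgW]
      ring
    simp_rw [h1, Finset.sum_add_distrib, Finset.sum_sub_distrib, ← Finset.sum_mul, hW1]
    simp [hD]
  have hg0 : ∀ y', gF e Q0 y' = gW := by
    intro y'
    have h1 : (fun i => ∑ y, Real.negMulLog (Q0 (e i) y' y)) = Matrix.mulVec (Vm e Q0 y') gW := by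
      funext i
      have := hWg (e i)
      rw [hSeq _ (heS i), sub_self, add_zero] at this
      exact this.symm
    rw [gF, h1, Matrix.mulVec_mulVec, Matrix.nonsing_inv_mul _ (hdet0 y'), Matrix.one_mulVec]
  have hM0 : ∀ y' y, Mm e Q0 y' y = pY y * Real.exp C := by
    intro y' y
    rw [Mm, hg0, hgW]
    simp only
    rw [neg_sub, sub_neg_eq_add, add_comm, Real.exp_add, Real.exp_log (hpYpos y)]
  have hR0 : ∀ y' y, Rm e Q0 1 y' y = pY y := by
    intro y' y
    simp only [Rm, hM0, Pi.one_apply, mul_one, ← Finset.sum_mul, hpY1, one_mul]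
    field_simp
  obtain ⟨k0⟩ := id hYne
  set b : X → Y → ℝ := fun x y => Bm e Q0 1 x k0 y with hb
  have hBb : ∀ x y' y, Bm e Q0 1 x y' y = b x y := by
    intro x y' y
    simp only [hb, Bm, hR0]
    rfl
  have hbsum : ∀ i, ∑ y, b (e i) y = pX (e i) := by
    intro i
    have h1 : ∀ y, b (e i) y = pY y * (Vm e Q0 k0)⁻¹ y i := by
      intro y
      simp only [hb, Bm, hR0, heinj.eq_iff, Finset.sum_ite_eq', Finset.mem_univ, if_true]
      ring
    have h2 : pY = Matrix.vecMul (fun i => pX (e i)) (Vm e Q0 k0) := by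
      funext y
      simp only [hpY]
      rw [hsumS]
      · rfl
      · intro x hx; rw [hsupp x hx, zero_mul]
    have h3 : Matrix.vecMul pY (Vm e Q0 k0)⁻¹ = fun i => pX (e i) := by
      rw [h2, Matrix.vecMul_vecMul, Matrix.mul_nonsing_inv _ (hdet0 k0), Matrix.vecMul_one]
    simp_rw [h1]
    exact congrFun h3 i
  -- constants
  obtain ⟨p, hp, hpb⟩ : ∃ p : ℝ, 0 < p ∧ ∀ x ∈ S, p ≤ ∑ y, b x y := by
    obtain ⟨i1, _, hi1⟩ := Finset.exists_min_image Finset.univ (fun i => pX (e i))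
      Finset.univ_nonempty
    refine ⟨pX (e i1), hSpos _ (heS i1), fun x hx => ?_⟩
    obtain ⟨i, rfl⟩ := (hS x).1 hx
    rw [hbsum]
    exact hi1 i (Finset.mem_univ i)
  obtain ⟨β, hβ0, hβ⟩ : ∃ β : ℝ, 0 < β ∧ ∀ x ∈ S, ∑ y, |b x y| ≤ β := by
    refine ⟨∑ x, ∑ y, |b x y| + 1, ?_, fun x _ => ?_⟩
    · have : 0 ≤ ∑ x, ∑ y, |b x y| :=
        Finset.sum_nonneg fun _ _ => Finset.sum_nonneg fun _ _ => abs_nonneg _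
      linarith
    · have := Finset.single_le_sum (f := fun x => ∑ y, |b x y|)
        (fun _ _ => Finset.sum_nonneg fun _ _ => abs_nonneg _) (Finset.mem_univ x)
      linarith
  set η : ℝ := min 1 (p / (2 * β)) with hη
  have hη0 : 0 < η := lt_min one_pos (by positivity)
  have hη1 : η ≤ 1 := min_le_left _ _
  have hβη : β * η ≤ p / 2 := by
    calc β * η ≤ β * (p / (2 * β)) := mul_le_mul_of_nonneg_left (min_le_right _ _) hβ0.le
      _ = p / 2 := by field_simp
  have hcY : (0:ℝ) < Fintype.card Y := by exact_mod_cast Fintype.card_pos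
  set ε : ℝ := η * (p / 2) / (Fintype.card Y * 2) with hε
  have hε0 : 0 < ε := by positivity
  have hεle : ε * Fintype.card Y * 2 ≤ η * (p / 2) := by
    rw [hε]; apply le_of_eq; field_simp
  -- eventual conditions
  have E3 : ∀ᶠ z in nhds (Q0, (1 : Y → ℝ)), ∀ x y' y, |Bm e z.1 z.2 x y' y - b x y| < ε := by
    refine Filter.eventually_all.2 fun x => Filter.eventually_all.2 fun y' =>
      Filter.eventually_all.2 fun y => ?_
    have h1 := cont_Bm e Q0 x y' y (hdet0 y')
    have h2 := Metric.tendsto_nhds.1 h1 ε hε0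
    filter_upwards [h2] with z hz
    rw [Real.dist_eq] at hz
    simp only [hBb] at hz
    exact hz
  rw [nhds_prod_eq, Filter.eventually_prod_iff] at E3
  obtain ⟨pa, hpa, pb, hpb', hab⟩ := E3
  obtain ⟨ε', hε', hball⟩ := Metric.eventually_nhds_iff.1 hpb'
  have E4 : ∀ᶠ Q in nhds Q0, ∀ i k j, |Mm e Q i j - Mm e Q k j| < ε' / 2 * Mm e Q k j := by
    refine Filter.eventually_all.2 fun i => Filter.eventually_all.2 fun k =>
      Filter.eventually_all.2 fun j => ?_
    have hc : ∀ i, ContinuousAt (fun Q => Mm e Q i j) Q0 := fun i =>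
      Real.continuous_exp.continuousAt.comp (cont_gF e Q0 i j (hdet0 i)).neg
    refine ContinuousAt.eventually_lt ((hc i).sub (hc k)).abs (continuousAt_const.mul (hc k)) ?_
    rw [hM0, hM0, sub_self, abs_zero]
    have := hpYpos j
    positivity
  have E1 : ∀ᶠ Q in nhds Q0, ∀ y', (Vm e Q y').det ≠ 0 := by
    refine Filter.eventually_all.2 fun y' => ?_
    have h1 : Continuous (fun Q : X → Y → Y → ℝ => (Vm e Q y').det) := by
      apply Continuous.matrix_det
      unfold Vm
      exact continuous_pi fun i => continuous_pi fun j => by fun_prop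
    exact h1.continuousAt.eventually_ne (hdet0 y').ne_zero
  have E2 : ∀ᶠ Q in nhds Q0, ∀ x y', x ∉ S →
      ∑ y, Q x y' y * gF e Q y' y < ∑ y, Real.negMulLog (Q x y' y) := by
    refine Filter.eventually_all.2 fun x => Filter.eventually_all.2 fun y' => ?_
    by_cases hx : x ∈ S
    · simp [hx]
    have : ∀ᶠ Q in nhds Q0, ∑ y, Q x y' y * gF e Q y' y < ∑ y, Real.negMulLog (Q x y' y) := by
      refine ContinuousAt.eventually_lt (f := fun Q : X → Y → Y → ℝ => ∑ y, Q x y' y * gF e Q y' y)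
        (g := fun Q : X → Y → Y → ℝ => ∑ y, Real.negMulLog (Q x y' y)) ?_ ?_ ?_
      · refine tendsto_finsetSum _ fun y _ => ?_
        exact ContinuousAt.mul (Continuous.continuousAt (by fun_prop)) (cont_gF e Q0 y' y (hdet0 y'))
      · apply Continuous.continuousAt
        refine continuous_finsetSum _ fun z _ => ?_
        exact Real.continuous_negMulLog.comp (by fun_prop)
      · rw [hg0]
        have h1 := hWg x
        have h2 := hSlt x hx
        simp only [hQ0]
        linarith
    filter_upwards [this] with Q hQ _ using hQ
  obtain ⟨δ, hδ, hδQ⟩ := Metric.eventually_nhds_iff.1 ((hpa.and E4).and (E1.and E2))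
  refine ⟨δ / 2, by positivity, fun Q hQ hQW => ?_⟩
  have hdist : dist Q Q0 < δ := by
    have : dist Q Q0 ≤ δ / 2 := by
      refine (dist_pi_le_iff (by positivity)).2 fun x => (dist_pi_le_iff (by positivity)).2 fun y' =>
        (dist_pi_le_iff (by positivity)).2 fun y => ?_
      rw [Real.dist_eq]
      exact hQW x y' y
    linarith
  obtain ⟨⟨hQa, hQ4⟩, hQ1, hQ2⟩ := hδQ hdist
  obtain ⟨v, r, hr, hv, hv1, hMv⟩ := perron_near (Mm e Q) (fun i j => Real.exp_pos _) (ε' / 2)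
    (fun i k j => (hQ4 i k j).le)
  have hvb : pb v := by
    apply hball
    have : dist v 1 ≤ ε' / 2 := by
      refine (dist_pi_le_iff (by positivity)).2 fun y => ?_
      rw [Real.dist_eq]; exact hv1 y
    linarith
  have hBε := hab hQa hvb
  refine final_det e Q hQ S hS (fun y' => (hQ1 y').isUnit) (fun x hx y' => hQ2 x y' hx) v r hr hv hMv ?_
  refine inU_nonneg_of_cone _ η hη1 fun n xs => ?_
  refine inU_cone (Bm e Q v) b S ?_ p β η ε hη0 hη1 hp hpb hβ hβη hεle
    (fun x _ y' y => (hBε x y' y).le) n xs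
  intro x hx y' y
  refine Finset.sum_eq_zero fun i _ => if_neg ?_
  intro h
  exact hx ((hS x).2 ⟨i, h⟩)
end
end

section
/- Let Q be a W-centered δ-approximately memoryless POST channel. If δ < min_{x∈𝒳} max_{y∈𝒴} W(y|x), then Q is indecomposable: for every ε > 0 there exists an integer N such that for all n ≥ N, every product of n matrices chosen (with repetition) from the family of state transition matrices {𝑄^{(s)}_x : x ∈ 𝒳} has, within each row, all entries differing from one another by at most ε. -/
open scoped BigOperators

noncomputable section

/-- The state transition matrix `𝑄^{(s)}_x`, with `(y,y')`-entry `Q(y|x,y')`. -/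
def stateMatrix {X Y : Type*} (Q : X → Y → Y → ℝ) (x : X) : Matrix Y Y ℝ :=
  Matrix.of fun y y' => Q x y' y

lemma post_contract {Y : Type*} [Fintype Y] [DecidableEq Y] (f a b : Y → ℝ) (z₀ : Y) (c D : ℝ)
    (hf : ∀ z z', |f z - f z'| ≤ D) (ha : ∀ z, 0 ≤ a z) (hb : ∀ z, 0 ≤ b z)
    (ha1 : ∑ z, a z = 1) (hb1 : ∑ z, b z = 1) (hac : c ≤ a z₀) (hbc : c ≤ b z₀) (hc1 : c ≤ 1) :
    ∑ z, f z * a z - ∑ z, f z * b z ≤ (1 - c) * D := by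
  have : Nonempty Y := ⟨z₀⟩
  obtain ⟨u, hu⟩ := Finite.exists_max f
  obtain ⟨v, hv⟩ := Finite.exists_min f
  have key : ∀ (a : Y → ℝ), (∀ z, 0 ≤ a z) → (∑ z, a z = 1) → c ≤ a z₀ →
      (∑ z, f z * a z ≤ f u * (1 - c) + f z₀ * c) ∧
      (f v * (1 - c) + f z₀ * c ≤ ∑ z, f z * a z) := by
    intro a ha ha1 hac
    have e1 : ∑ z, f z * a z = f z₀ * a z₀ + ∑ z ∈ Finset.univ.erase z₀, f z * a z :=
      (Finset.add_sum_erase _ _ (Finset.mem_univ z₀)).symm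
    have e2 : a z₀ + ∑ z ∈ Finset.univ.erase z₀, a z = 1 := by
      rw [← ha1]; exact Finset.add_sum_erase _ _ (Finset.mem_univ z₀)
    have e3 : ∑ z ∈ Finset.univ.erase z₀, f z * a z ≤
        f u * ∑ z ∈ Finset.univ.erase z₀, a z := by
      rw [Finset.mul_sum]
      exact Finset.sum_le_sum fun z _ => mul_le_mul_of_nonneg_right (hu z) (ha z)
    have e4 : f v * ∑ z ∈ Finset.univ.erase z₀, a z ≤
        ∑ z ∈ Finset.univ.erase z₀, f z * a z := by
      rw [Finset.mul_sum]
      exact Finset.sum_le_sum fun z _ => mul_le_mul_of_nonneg_right (hv z) (ha z)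
    have e5 : ∑ z ∈ Finset.univ.erase z₀, a z = 1 - a z₀ := by linarith
    rw [e5] at e3 e4
    constructor
    · nlinarith [mul_nonneg (sub_nonneg.2 (hu z₀)) (sub_nonneg.2 hac)]
    · nlinarith [mul_nonneg (sub_nonneg.2 (hv z₀)) (sub_nonneg.2 hac)]
  have h1 := (key a ha ha1 hac).1
  have h2 := (key b hb hb1 hbc).2
  have h3 := le_trans (le_abs_self _) (hf u v)
  nlinarith [mul_nonneg (sub_nonneg.2 hc1) (sub_nonneg.2 h3)]

lemma post_prod_bound {X Y : Type*} [Fintype X] [Fintype Y] [DecidableEq Y]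
    (Q : X → Y → Y → ℝ) (hQ : IsPOST Q) (c : ℝ) (hc1 : c ≤ 1)
    (hc : ∀ x, ∃ z, ∀ y', c ≤ Q x y' z) (l : List X) :
    ∀ y y₁ y₂ : Y, |(l.map (stateMatrix Q)).prod y y₁ - (l.map (stateMatrix Q)).prod y y₂|
      ≤ (1 - c) ^ l.length := by
  induction l using List.reverseRecOn with
  | nil =>
    intro y y₁ y₂
    simp only [List.map_nil, List.prod_nil, List.length_nil, pow_zero, Matrix.one_apply]
    split_ifs <;> norm_num
  | append_singleton l x ih =>
    intro y y₁ y₂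
    obtain ⟨z₀, hz⟩ := hc x
    have h := fun y₁ y₂ => post_contract (fun z => (l.map (stateMatrix Q)).prod y z) (Q x y₁)
      (Q x y₂) z₀ c _ (ih y) (hQ.1 x y₁) (hQ.1 x y₂) (hQ.2 x y₁) (hQ.2 x y₂) (hz y₁) (hz y₂) hc1
    have e : ∀ y', ((l ++ [x]).map (stateMatrix Q)).prod y y' =
        ∑ z, (l.map (stateMatrix Q)).prod y z * Q x y' z := by
      intro y'
      rw [List.map_append, List.prod_append, Matrix.mul_apply]
      simp only [List.map_cons, List.map_nil, List.prod_cons, List.prod_nil, mul_one]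
      rfl
    have h1 := h y₁ y₂
    have h2 := h y₂ y₁
    rw [e, e, List.length_append, List.length_singleton, pow_succ', abs_le]
    constructor <;> linarith

/-- A `W`-centered `δ`-approximately memoryless POST channel `Q` with
`δ < min_{x} max_{y} W(y|x)` is indecomposable: for every `ε > 0` there is `N` such that
for all `n ≥ N` every product of `n` state transition matrices of `Q` has, within each
row, all entries differing by at most `ε`. -/
theorem approximately_memoryless_indecomposable
    {X Y : Type*} [Fintype X] [Fintype Y] [DecidableEq Y]
    (hX : 2 ≤ Fintype.card X) (hY : 2 ≤ Fintype.card Y)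
    (W : X → Y → ℝ) (hW0 : ∀ x y, 0 ≤ W x y) (hW1 : ∀ x, ∑ y : Y, W x y = 1)
    (Q : X → Y → Y → ℝ) (hQ : IsPOST Q)
    (δ : ℝ) (happrox : ∀ x y' y, |Q x y' y - W x y| ≤ δ)
    (hδ : ∀ x : X, ∃ y : Y, δ < W x y) :
    ∀ ε > (0 : ℝ), ∃ N : ℕ, ∀ n ≥ N, ∀ xs : Fin n → X, ∀ y y₁ y₂ : Y,
      |(List.ofFn fun t : Fin n => stateMatrix Q (xs t)).prod y y₁ -
        (List.ofFn fun t : Fin n => stateMatrix Q (xs t)).prod y y₂| ≤ ε := by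
  intro ε hε
  have : Nonempty X := Fintype.card_pos_iff.1 (by omega)
  have : Nonempty Y := Fintype.card_pos_iff.1 (by omega)
  choose g hg using hδ
  obtain ⟨x₀, hx₀⟩ := Finite.exists_min fun x => W x (g x) - δ
  have hcpos : 0 < W x₀ (g x₀) - δ := sub_pos.2 (hg x₀)
  generalize W x₀ (g x₀) - δ = c at hx₀ hcpos
  have hc : ∀ x, ∃ z, ∀ y', c ≤ Q x y' z := fun x => ⟨g x, fun y' => by
    have h1 := (abs_le.1 (happrox x y' (g x))).1
    have h2 := hx₀ x
    linarith⟩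
  have hc1 : c ≤ 1 := by
    obtain ⟨z, hz⟩ := hc x₀
    obtain ⟨y'⟩ := ‹Nonempty Y›
    refine (hz y').trans ?_
    rw [← hQ.2 x₀ y']
    exact Finset.single_le_sum (fun i _ => hQ.1 x₀ y' i) (Finset.mem_univ z)
  obtain ⟨N, hN⟩ := exists_pow_lt_of_lt_one hε (show 1 - c < 1 by linarith)
  refine ⟨N, fun n hn xs y y₁ y₂ => ?_⟩
  have h := post_prod_bound Q hQ c hc1 hc (List.ofFn xs) y y₁ y₂
  rw [List.map_ofFn, List.length_ofFn] at h
  refine h.trans (le_trans ?_ hN.le)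
  exact pow_le_pow_of_le_one (by linarith) (by linarith) hn
end
end

section
/- Let W be a memoryless surjective channel on finite alphabets 𝒳 and 𝒴, and consider the POST channel Q degenerate to W, i.e., Q(y|x,y′) = W(y|x) for all y′. Then the optimization problem defining C*_f(Q) — maximize I(X;Y|Y′) over joint pmfs P on 𝒳 × 𝒴 subject to ∑_{x,y′} P(x,y′) W(y|x) = ∑_x P(x,y) for all y — admits the product distribution P_X^W ⊗ P_Y^W as its unique maximizer, where P_X^W and P_Y^W are the capacity-achieving input and output distributions of W. -/
open scoped BigOperators

noncomputable section

lemma gapTerm_nonneg {r s : ℝ} (hr : 0 ≤ r) (hs : 0 ≤ s) (h : s = 0 → r = 0) :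
    0 ≤ r * Real.log (r / s) - r + s ∧
      (r * Real.log (r / s) - r + s = 0 → r = s) := by
  rcases hr.eq_or_lt with h0 | hr
  · subst h0
    constructor
    · simpa using hs
    · intro h; simpa using h.symm
  · have hs : 0 < s := lt_of_le_of_ne hs (fun e => hr.ne' (h e.symm))
    have hl : Real.log (r / s) = - Real.log (s / r) := by
      rw [← Real.log_inv, inv_div]
    have hp : 0 < s / r := div_pos hs hr
    have e : r * (s / r) = s := by field_simp
    constructor
    · have := mul_le_mul_of_nonneg_left (Real.log_le_sub_one_of_pos hp) hr.le
      rw [hl]; nlinarith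
    · intro h
      by_contra hne
      have h1 : s / r ≠ 1 := by
        intro h2
        rw [div_eq_one_iff_eq hr.ne'] at h2
        exact hne h2.symm
      have := mul_lt_mul_of_pos_left (Real.log_lt_sub_one_of_pos hp h1) hr
      rw [hl] at h; nlinarith

lemma fbMI_eq_aux {X Y : Type*} [Fintype X] [Fintype Y]
    (W : X → Y → ℝ) (hW0 : ∀ x y, 0 ≤ W x y) (hW1 : ∀ x, ∑ y : Y, W x y = 1)
    (q : Y → ℝ) (hq : ∀ y, 0 < q y) (P : X → Y → ℝ) (hP : ∀ x y, 0 ≤ P x y) :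
    fbMI (fun x (_ : Y) y => W x y) P =
      (∑ x, ∑ y', P x y' * ∑ y, W x y * Real.log (W x y / q y)) -
      ∑ y', ∑ y, (∑ x, P x y' * W x y) *
        Real.log ((∑ x, P x y' * W x y) / ((∑ x, P x y') * q y)) := by
  have key : ∀ x y y', P x y' * W x y * Real.log ((P x y' * W x y * ∑ a', P a' y') /
      (P x y' * (∑ a', P a' y' * W a' y))) =
      P x y' * (W x y * Real.log (W x y / q y)) - P x y' * W x y *
        Real.log ((∑ x, P x y' * W x y) / ((∑ x, P x y') * q y)) := by
    intro x y y'
    rcases (hP x y').eq_or_lt with h | hp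
    · simp [← h]
    rcases (hW0 x y).eq_or_lt with h | hw
    · simp [← h]
    have hm : 0 < ∑ x, P x y' :=
      lt_of_lt_of_le hp (Finset.single_le_sum (f := fun x => P x y') (fun i _ => hP i y') (Finset.mem_univ x))
    have hr : 0 < ∑ x, P x y' * W x y :=
      lt_of_lt_of_le (mul_pos hp hw) (Finset.single_le_sum (f := fun x => P x y' * W x y)
        (fun i _ => mul_nonneg (hP i y') (hW0 i y)) (Finset.mem_univ x))
    have hqy := hq y
    rw [Real.log_div (by positivity) (by positivity), Real.log_div (by positivity) (by positivity),
      Real.log_div (by positivity) (by positivity), Real.log_mul (by positivity) (by positivity),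
      Real.log_mul (by positivity) (by positivity), Real.log_mul (by positivity) (by positivity),
      Real.log_mul (by positivity) (by positivity)]
    ring
  unfold fbMI condMI
  simp only [← Finset.mul_sum, hW1, mul_one]
  simp only [key, Finset.sum_sub_distrib]
  congr 1
  · refine Finset.sum_congr rfl fun x _ => ?_
    rw [Finset.sum_comm]
    simp only [Finset.mul_sum]
  · rw [Finset.sum_comm, Finset.sum_comm (s := (Finset.univ : Finset Y))]
    simp only [Finset.sum_mul]
    rw [Finset.sum_comm (s := (Finset.univ : Finset Y)) (t := (Finset.univ : Finset Y))]
    · rw [Finset.sum_comm]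
      refine Finset.sum_congr rfl fun x _ => ?_
      rw [Finset.sum_comm]


/-- For a memoryless surjective channel `W`, when the POST channel
degenerates to `W` (i.e. `Q(y|x,y') = W(y|x)`), the optimization problem defining
`C*_f(Q)` admits the product distribution `P_X^W ⊗ P_Y^W` as its unique maximizer. -/
theorem degenerate_unique_maximizer
    {X Y : Type*} [Fintype X] [Fintype Y] [DecidableEq X] [DecidableEq Y]
    (hX : 2 ≤ Fintype.card X) (hY : 2 ≤ Fintype.card Y)
    (W : X → Y → ℝ) (hW0 : ∀ x y, 0 ≤ W x y) (hW1 : ∀ x, ∑ y : Y, W x y = 1)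
    -- `pX` is a capacity-achieving input distribution of `W`
    (pX : X → ℝ) (hpX : IsPmf pX)
    (hpXopt : ∀ p : X → ℝ, IsPmf p → mlMI W p ≤ mlMI W pX)
    -- surjectivity of `W`, witnessed by `S ⊆ 𝒳` with `|S| = |𝒴|`
    (S : Finset X) (hScard : S.card = Fintype.card Y)
    (hSpos : ∀ x ∈ S, 0 < pX x)
    (hSeq : ∀ x ∈ S,
      ∑ y : Y, W x y * Real.log (W x y / ∑ x' : X, pX x' * W x' y) = mlMI W pX)
    (hSlt : ∀ x ∉ S,
      ∑ y : Y, W x y * Real.log (W x y / ∑ x' : X, pX x' * W x' y) < mlMI W pX)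
    (hSrank : LinearIndependent ℝ (fun x : S => W x.val)) :
    IsFbMaximizer (fun x (_ : Y) y => W x y)
        (fun x y => pX x * ∑ x' : X, pX x' * W x' y) ∧
      ∀ P : X → Y → ℝ, IsFbMaximizer (fun x (_ : Y) y => W x y) P →
        P = fun x y => pX x * ∑ x' : X, pX x' * W x' y := by
  obtain ⟨hp0, hp1⟩ := hpX
  have hq : ∀ y, 0 < ∑ x' : X, pX x' * W x' y := by
    intro y
    have hnn : ∀ x ∈ Finset.univ, 0 ≤ pX x * W x y := fun x _ => mul_nonneg (hp0 x) (hW0 x y)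
    refine lt_of_le_of_ne (Finset.sum_nonneg hnn) fun h => ?_
    have hz := (Finset.sum_eq_zero_iff_of_nonneg hnn).1 h.symm
    have htop := hSrank.span_eq_top_of_card_eq_finrank' (by simp [hScard])
    have hle : Submodule.span ℝ (Set.range (fun x : S => W x.val)) ≤
        LinearMap.ker (LinearMap.proj y : (Y → ℝ) →ₗ[ℝ] ℝ) := by
      rw [Submodule.span_le]
      rintro _ ⟨x, rfl⟩
      have := hz x.val (Finset.mem_univ _)
      have := (mul_eq_zero.1 this).resolve_left (hSpos x.val x.2).ne'
      simpa using this
    rw [htop] at hle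
    have h1 : (fun _ => 1 : Y → ℝ) ∈ LinearMap.ker (LinearMap.proj y : (Y → ℝ) →ₗ[ℝ] ℝ) :=
      hle Submodule.mem_top
    simp at h1
  have hcD : mlMI W pX = ∑ x, pX x * ∑ y : Y, W x y * Real.log (W x y / ∑ x' : X, pX x' * W x' y) := by
    simp only [mlMI, Finset.mul_sum, mul_assoc]
  generalize hc : mlMI W pX = c at *
  have hmain := fbMI_eq_aux W hW0 hW1 (fun y => ∑ x' : X, pX x' * W x' y) hq
  have hq1 : ∑ y, ∑ x' : X, pX x' * W x' y = 1 := by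
    rw [Finset.sum_comm]
    simp only [← Finset.mul_sum, hW1, mul_one, hp1]
  set q : Y → ℝ := fun y => ∑ x' : X, pX x' * W x' y with hqdef
  have hqy : ∀ y, ∑ x' : X, pX x' * W x' y = q y := fun y => rfl
  simp only [hqy] at *
  set D : X → ℝ := fun x => ∑ y : Y, W x y * Real.log (W x y / q y) with hDdef
  have hDx : ∀ x, ∑ y : Y, W x y * Real.log (W x y / q y) = D x := fun x => rfl
  simp only [hDx] at *
  have hqy2 : ∀ y, ∑ x' : X, pX x' * W x' y = q y := fun y => rfl
  have hDle : ∀ x, D x ≤ c := fun x => by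
    by_cases h : x ∈ S
    · exact (hSeq x h).le
    · exact (hSlt x h).le
  have hpS : ∀ x ∉ S, pX x = 0 := by
    intro x hx
    have h0 : ∑ x, pX x * (c - D x) = 0 := by
      simp only [mul_sub, Finset.sum_sub_distrib, ← Finset.sum_mul, hp1]
      linarith
    have := (Finset.sum_eq_zero_iff_of_nonneg
      (fun x _ => mul_nonneg (hp0 x) (sub_nonneg.2 (hDle x)))).1 h0 x (Finset.mem_univ x)
    exact (mul_eq_zero.1 this).resolve_right (sub_pos.2 (hSlt x hx)).ne'
  have hgap : ∀ P : X → Y → ℝ, IsJointPmf P → c - fbMI (fun x (_ : Y) y => W x y) P =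
      (∑ x, ∑ y', P x y' * (c - D x)) +
      ∑ y', ∑ y, ((∑ x, P x y' * W x y) *
        Real.log ((∑ x, P x y' * W x y) / ((∑ x, P x y') * q y)) - (∑ x, P x y' * W x y)
          + (∑ x, P x y') * q y) := by
    rintro P ⟨hP0, hP1⟩
    rw [hmain P hP0]
    have e1 : ∑ y', ∑ y, ∑ x, P x y' * W x y = 1 := by
      rw [← hP1, Finset.sum_comm (s := (Finset.univ : Finset X))]
      refine Finset.sum_congr rfl fun y' _ => ?_
      rw [Finset.sum_comm]
      simp only [← Finset.mul_sum, hW1, mul_one]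
    have e2 : ∑ y', ∑ y, (∑ x, P x y') * q y = 1 := by
      simp only [← Finset.mul_sum, hq1, mul_one]
      rw [← hP1, Finset.sum_comm]
    have e3 : ∑ x, ∑ y', P x y' * c = c := by
      simp only [← Finset.sum_mul, hP1, one_mul]
    simp only [mul_sub, Finset.sum_sub_distrib, Finset.sum_add_distrib, e1, e2, e3]
    ring
  have hA : ∀ P : X → Y → ℝ, IsJointPmf P → ∀ x y', 0 ≤ P x y' * (c - D x) :=
    fun P hP x y' => mul_nonneg (hP.1 x y') (sub_nonneg.2 (hDle x))
  have hB : ∀ P : X → Y → ℝ, IsJointPmf P → ∀ y' y, _ := fun P hP y' y =>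
    gapTerm_nonneg (r := ∑ x, P x y' * W x y) (s := (∑ x, P x y') * q y)
      (Finset.sum_nonneg fun x _ => mul_nonneg (hP.1 x y') (hW0 x y))
      (mul_nonneg (Finset.sum_nonneg fun x _ => hP.1 x y') (hq y).le)
      (fun h => by
        have h := (mul_eq_zero.1 h).resolve_right (hq y).ne'
        have h := (Finset.sum_eq_zero_iff_of_nonneg (fun x _ => hP.1 x y')).1 h
        exact Finset.sum_eq_zero fun x hx => by rw [h x hx, zero_mul])
  have hle : ∀ P : X → Y → ℝ, IsJointPmf P → fbMI (fun x (_ : Y) y => W x y) P ≤ c := by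
    intro P hP
    have h1 := hgap P hP
    have h2 := Finset.sum_nonneg fun x (_ : x ∈ Finset.univ) =>
      Finset.sum_nonneg fun y' (_ : y' ∈ Finset.univ) => hA P hP x y'
    have h3 := Finset.sum_nonneg fun x (_ : x ∈ Finset.univ) =>
      Finset.sum_nonneg fun y' (_ : y' ∈ Finset.univ) => (hB P hP x y').1
    linarith
  have hprod : IsJointPmf (fun x y => pX x * q y) := by
    refine ⟨fun x y => mul_nonneg (hp0 x) (hq y).le, ?_⟩
    simp only [← Finset.mul_sum, hq1, mul_one, hp1]
  have hstat : StationaryFor (fun x (_ : Y) y => W x y) (fun x y => pX x * q y) := by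
    intro y
    simp only [← Finset.sum_mul, ← Finset.mul_sum, hq1, hp1, one_mul, mul_one]
    rfl
  have hval : fbMI (fun x (_ : Y) y => W x y) (fun x y => pX x * q y) = c := by
    have h := hgap _ hprod
    have ez : ∀ y' y, ∑ x, pX x * q y' * W x y = q y' * q y := by
      intro y' y
      rw [← hqy2 y, Finset.mul_sum]
      exact Finset.sum_congr rfl fun x _ => by ring
    have e4 : ∑ x, ∑ y', pX x * q y' * (c - D x) = 0 := by
      refine Finset.sum_eq_zero fun x _ => Finset.sum_eq_zero fun y' _ => ?_
      by_cases hx : x ∈ S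
      · rw [hSeq x hx]; ring
      · rw [hpS x hx]; ring
    have e5 : ∀ y' y, q y' * q y / (q y' * q y) = 1 := fun y' y =>
      div_self (mul_pos (hq y') (hq y)).ne'
    simp only [ez, ← Finset.sum_mul, hp1, one_mul, e5, Real.log_one, mul_zero, zero_sub,
      neg_add_cancel, Finset.sum_const_zero] at h
    simp only [Finset.sum_mul] at h e4
    linarith
  refine ⟨⟨hprod, hstat, fun P' hP' _ => hval.symm ▸ hle P' hP'⟩, ?_⟩
  rintro P ⟨hP, hPs, hPm⟩
  have hPc : fbMI (fun x (_ : Y) y => W x y) P = c :=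
    le_antisymm (hle P hP) (hval ▸ hPm _ hprod hstat)
  have h1 := hgap P hP
  have h2' := fun x (_ : x ∈ Finset.univ) =>
      Finset.sum_nonneg fun y' (_ : y' ∈ Finset.univ) => hA P hP x y'
  have h3' := fun x (_ : x ∈ Finset.univ) =>
      Finset.sum_nonneg fun y' (_ : y' ∈ Finset.univ) => (hB P hP x y').1
  have h2 := Finset.sum_nonneg h2'
  have h3 := Finset.sum_nonneg h3'
  have z2 := (Finset.sum_eq_zero_iff_of_nonneg h2').1 (by linarith)
  have z3 := (Finset.sum_eq_zero_iff_of_nonneg h3').1 (by linarith)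
  have hPS : ∀ x ∉ S, ∀ y', P x y' = 0 := by
    intro x hx y'
    have := (Finset.sum_eq_zero_iff_of_nonneg (fun y' _ => hA P hP x y')).1
      (z2 x (Finset.mem_univ _)) y' (Finset.mem_univ _)
    exact (mul_eq_zero.1 this).resolve_right (sub_pos.2 (hSlt x hx)).ne'
  have hr : ∀ y' y, ∑ x, P x y' * W x y = (∑ x, P x y') * q y := by
    intro y' y
    exact (hB P hP y' y).2 ((Finset.sum_eq_zero_iff_of_nonneg (fun y _ => (hB P hP y' y).1)).1
      (z3 y' (Finset.mem_univ _)) y (Finset.mem_univ _))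
  have hm : ∀ y, ∑ x, P x y = q y := by
    intro y
    have h := hPs y
    rw [Finset.sum_comm] at h
    simp only [hr, ← Finset.sum_mul] at h
    rw [Finset.sum_comm, hP.2, one_mul] at h
    exact h.symm
  have hlin : ∀ y', ∀ x ∈ S, P x y' - q y' * pX x = 0 := by
    intro y'
    have hli := Fintype.linearIndependent_iff.1 hSrank (fun x => P x.val y' - q y' * pX x.val) (by
      ext y
      simp only [Finset.sum_apply, Pi.smul_apply, smul_eq_mul, Pi.zero_apply]
      rw [Finset.sum_coe_sort S (fun x => (P x y' - q y' * pX x) * W x y),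
        Finset.sum_subset (Finset.subset_univ S) (fun x _ hx => by
          rw [hPS x hx, hpS x hx]; ring)]
      simp only [sub_mul, Finset.sum_sub_distrib, hr, hm, mul_assoc, ← Finset.mul_sum, hqy2, sub_self])
    exact fun x hx => hli ⟨x, hx⟩
  funext x y
  by_cases hx : x ∈ S
  · linarith [hlin y x hx]
  · rw [hPS x hx, hpS x hx, zero_mul]
end
end

section
/- Let W be a memoryless surjective channel with |𝒳| = |𝒴|. There exists δ > 0 such that for every W-centered δ-approximately memoryless POST channel Q, the optimization problem defining C*_f(Q) — maximize I(X;Y|Y′) over joint pmfs P on 𝒳 × 𝒴 subject to ∑_{x,y′} P(x,y′) Q(y|x,y′) = ∑_x P(x,y) for all y — has a unique maximizer. -/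
open scoped BigOperators

noncomputable section

/-- Homogeneous version of mutual information of the channel `V` with input vector `u`. -/
def Jfun {α : Type*} [Fintype α] (V : α → α → ℝ) (u : α → ℝ) : ℝ :=
  ∑ y : α, (Real.negMulLog (∑ x : α, u x * V x y) - ∑ x : α, u x * Real.negMulLog (V x y))
    - Real.negMulLog (∑ x : α, u x)

section helpers

variable {α : Type*} [Fintype α]

lemma sum_out (V : α → α → ℝ) (hV1 : ∀ x, ∑ y, V x y = 1) (u : α → ℝ) :
    ∑ y, ∑ x, u x * V x y = ∑ x, u x := by
  rw [Finset.sum_comm]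
  simp [← Finset.mul_sum, hV1]

lemma Jfun_zero (V : α → α → ℝ) (u : α → ℝ) (hu : ∀ x, u x = 0) : Jfun V u = 0 := by
  simp [Jfun, hu]

lemma Jfun_eq (V : α → α → ℝ) (hV1 : ∀ x, ∑ y, V x y = 1) (u : α → ℝ)
    (hs : 0 < ∑ x, u x) :
    Jfun V u = ∑ y : α, ((∑ x, u x) * Real.negMulLog ((∑ x, u x * V x y) / ∑ x, u x)
      - ∑ x : α, u x * Real.negMulLog (V x y)) := by
  have key : ∀ y, (∑ x, u x) * Real.negMulLog ((∑ x, u x * V x y) / ∑ x, u x)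
      = Real.negMulLog (∑ x, u x * V x y) + (∑ x, u x * V x y) * Real.log (∑ x, u x) := by
    intro y
    set s := ∑ x, u x
    set o := ∑ x, u x * V x y
    have h := Real.negMulLog_mul s (o / s)
    have e : s * (o / s) = o := by field_simp
    rw [e] at h
    rw [h]
    have e2 : o / s * Real.negMulLog s = - (o * Real.log s) := by
      rw [Real.negMulLog]; field_simp
    rw [e2]; ring
  simp only [key, Jfun]
  have : ∑ y, (∑ x, u x * V x y) * Real.log (∑ x, u x) = - Real.negMulLog (∑ x, u x) := by
    rw [← Finset.sum_mul, sum_out V hV1, Real.negMulLog]; ring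
  simp only [Finset.sum_sub_distrib, Finset.sum_add_distrib, this]
  ring

lemma Jfun_smul (V : α → α → ℝ) (hV1 : ∀ x, ∑ y, V x y = 1) (u : α → ℝ)
    (hs : 0 < ∑ x, u x) :
    Jfun V u = (∑ x, u x) * Jfun V (fun x => u x / ∑ x, u x) := by
  have h1 : ∑ x, u x / ∑ x, u x = 1 := by
    rw [← Finset.sum_div]; exact div_self hs.ne'
  rw [Jfun_eq V hV1 u hs, Jfun_eq V hV1 (fun x => u x / ∑ x, u x) (by rw [h1]; norm_num)]
  simp only [h1]
  rw [Finset.mul_sum]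
  refine Finset.sum_congr rfl fun y _ => ?_
  have e1 : ∑ x, u x / (∑ x, u x) * V x y = (∑ x, u x * V x y) / ∑ x, u x := by
    rw [Finset.sum_div]; exact Finset.sum_congr rfl fun x _ => by ring
  have e2 : ∑ x, u x / (∑ x, u x) * Real.negMulLog (V x y)
      = (∑ x, u x * Real.negMulLog (V x y)) / ∑ x, u x := by
    rw [Finset.sum_div]; exact Finset.sum_congr rfl fun x _ => by ring
  rw [e1, e2]
  set s := ∑ x, u x
  field_simp

lemma persp {a b s t : ℝ} (ha : 0 ≤ a) (hb : 0 ≤ b) (hs : 0 < s) (ht : 0 < t) :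
    (s * Real.negMulLog (a / s) + t * Real.negMulLog (b / t)) / 2
      ≤ (s + t) / 2 * Real.negMulLog (((a + b) / 2) / ((s + t) / 2)) ∧
    (a / s ≠ b / t → (s * Real.negMulLog (a / s) + t * Real.negMulLog (b / t)) / 2
      < (s + t) / 2 * Real.negMulLog (((a + b) / 2) / ((s + t) / 2))) := by
  have hA : a / s ∈ Set.Ici (0 : ℝ) := by simp only [Set.mem_Ici]; positivity
  have hB : b / t ∈ Set.Ici (0 : ℝ) := by simp only [Set.mem_Ici]; positivity
  have hw1 : 0 < s / (s + t) := by positivity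
  have hw2 : 0 < t / (s + t) := by positivity
  have hw : s / (s + t) + t / (s + t) = 1 := by field_simp
  have e : s / (s + t) * (a / s) + t / (s + t) * (b / t) = ((a + b) / 2) / ((s + t) / 2) := by
    field_simp
  have e2 : (s * Real.negMulLog (a / s) + t * Real.negMulLog (b / t)) / 2
      = (s + t) / 2 * (s / (s + t) * Real.negMulLog (a / s)
        + t / (s + t) * Real.negMulLog (b / t)) := by
    field_simp
  rw [e2, ← e]
  have hp : 0 < (s + t) / 2 := by positivity
  constructor
  · exact mul_le_mul_of_nonneg_left
      (Real.concaveOn_negMulLog.2 hA hB hw1.le hw2.le hw) hp.le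
  · intro hne
    exact mul_lt_mul_of_pos_left
      (Real.strictConcaveOn_negMulLog.2 hA hB hne hw1 hw2 hw) hp

lemma Jfun_mid (V : α → α → ℝ) (hV0 : ∀ x y, 0 ≤ V x y) (hV1 : ∀ x, ∑ y, V x y = 1)
    (u v : α → ℝ) (hu : ∀ x, 0 ≤ u x) (hv : ∀ x, 0 ≤ v x)
    (hs : 0 < ∑ x, u x) (ht : 0 < ∑ x, v x) :
    (Jfun V u + Jfun V v) / 2 ≤ Jfun V (fun x => (u x + v x) / 2) ∧
    ((∃ y, (∑ x, u x * V x y) / (∑ x, u x) ≠ (∑ x, v x * V x y) / (∑ x, v x)) →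
      (Jfun V u + Jfun V v) / 2 < Jfun V (fun x => (u x + v x) / 2)) := by
  have lin : ∀ c : α → ℝ, ∑ x, (u x + v x) / 2 * c x
      = (∑ x, u x * c x + ∑ x, v x * c x) / 2 := by
    intro c
    rw [← Finset.sum_add_distrib, Finset.sum_div]
    exact Finset.sum_congr rfl fun x _ => by ring
  have lin1 : ∑ x, (u x + v x) / 2 = (∑ x, u x + ∑ x, v x) / 2 := by
    have := lin (fun _ => 1); simpa using this
  have hm : 0 < ∑ x, (u x + v x) / 2 := by rw [lin1]; positivity
  have hL : (Jfun V u + Jfun V v) / 2 = ∑ y : α,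
      ((((∑ x, u x) * Real.negMulLog ((∑ x, u x * V x y) / ∑ x, u x)
      + (∑ x, v x) * Real.negMulLog ((∑ x, v x * V x y) / ∑ x, v x)) / 2)
      - ∑ x : α, (u x + v x) / 2 * Real.negMulLog (V x y)) := by
    rw [Jfun_eq V hV1 u hs, Jfun_eq V hV1 v ht, ← Finset.sum_add_distrib, Finset.sum_div]
    refine Finset.sum_congr rfl fun y _ => ?_
    rw [lin]; ring
  rw [hL, Jfun_eq V hV1 _ hm]
  have ha : ∀ y, 0 ≤ ∑ x, u x * V x y := fun y =>
    Finset.sum_nonneg fun x _ => mul_nonneg (hu x) (hV0 x y)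
  have hb : ∀ y, 0 ≤ ∑ x, v x * V x y := fun y =>
    Finset.sum_nonneg fun x _ => mul_nonneg (hv x) (hV0 x y)
  simp only [lin, lin1]
  constructor
  · exact Finset.sum_le_sum fun y _ => sub_le_sub_right (persp (ha y) (hb y) hs ht).1 _
  · rintro ⟨y, hy⟩
    exact Finset.sum_lt_sum
      (fun y _ => sub_le_sub_right (persp (ha y) (hb y) hs ht).1 _)
      ⟨y, Finset.mem_univ _, sub_lt_sub_right ((persp (ha y) (hb y) hs ht).2 hy) _⟩

lemma mlMI_eq (W : α → α → ℝ) (hW0 : ∀ x y, 0 ≤ W x y) (p : α → ℝ) (hp : IsPmf p) :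
    mlMI W p = Jfun W p := by
  have hp1 := hp.2
  unfold mlMI Jfun
  rw [hp1, Real.negMulLog_one, sub_zero, Finset.sum_comm]
  refine Finset.sum_congr rfl fun y _ => ?_
  have : ∀ x, p x * W x y * Real.log (W x y / ∑ x', p x' * W x' y)
      = - (p x * W x y * Real.log (∑ x', p x' * W x' y)) - p x * Real.negMulLog (W x y) := by
    intro x
    by_cases h : p x * W x y = 0
    · rcases mul_eq_zero.1 h with h' | h' <;> simp [h']
    · have hpos : 0 < p x * W x y :=
        lt_of_le_of_ne (mul_nonneg (hp.1 x) (hW0 x y)) (Ne.symm h)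
      have ho : 0 < ∑ x', p x' * W x' y :=
        lt_of_lt_of_le hpos (Finset.single_le_sum
          (f := fun x' => p x' * W x' y)
          (fun i _ => mul_nonneg (hp.1 i) (hW0 i y)) (Finset.mem_univ x))
      rw [Real.log_div (right_ne_zero_of_mul h) ho.ne', Real.negMulLog]
      ring
  simp only [this, Finset.sum_sub_distrib, Finset.sum_neg_distrib, ← Finset.sum_mul]
  rw [Real.negMulLog]; ring

lemma fbMI_eq (Q : α → α → α → ℝ) (hQ : IsPOST Q) (P : α → α → ℝ) (hP : ∀ x y, 0 ≤ P x y) :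
    fbMI Q P = ∑ y', Jfun (fun x y => Q x y' y) (fun x => P x y') := by
  unfold fbMI condMI
  have e : ∀ x y', ∑ y, P x y' * Q x y' y = P x y' := by
    intro x y'; rw [← Finset.mul_sum, hQ.2, mul_one]
  simp only [e]
  have comm : ∀ f : α → α → α → ℝ, ∑ a, ∑ b, ∑ c, f a b c = ∑ c, ∑ b, ∑ a, f a b c := by
    intro f
    rw [Finset.sum_comm]
    rw [Finset.sum_comm]
    calc ∑ a, ∑ b, ∑ c, f a b c = ∑ a, ∑ c, ∑ b, f a b c :=
          Finset.sum_congr rfl fun a _ => Finset.sum_comm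
      _ = ∑ c, ∑ a, ∑ b, f a b c := Finset.sum_comm
      _ = _ := Finset.sum_congr rfl fun c _ => Finset.sum_comm
  rw [comm]
  refine Finset.sum_congr rfl fun y' _ => ?_
  unfold Jfun
  have : ∀ y x, P x y' * Q x y' y * Real.log (P x y' * Q x y' y * (∑ a', P a' y')
        / (P x y' * ∑ a', P a' y' * Q a' y' y))
      = P x y' * Q x y' y * Real.log (∑ a', P a' y')
        - (P x y' * Q x y' y * Real.log (∑ a', P a' y' * Q a' y' y))
        - P x y' * Real.negMulLog (Q x y' y) := by
    intro y x
    by_cases h : P x y' * Q x y' y = 0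
    · rcases mul_eq_zero.1 h with h' | h' <;> simp [h']
    · have hpos : 0 < P x y' * Q x y' y :=
        lt_of_le_of_ne (mul_nonneg (hP x y') (hQ.1 x y' y)) (Ne.symm h)
      have ho : 0 < ∑ a', P a' y' * Q a' y' y :=
        lt_of_lt_of_le hpos (Finset.single_le_sum
          (f := fun x' => P x' y' * Q x' y' y)
          (fun i _ => mul_nonneg (hP i y') (hQ.1 i y' y)) (Finset.mem_univ x))
      have hPx : 0 < P x y' := lt_of_le_of_ne (hP x y') (Ne.symm (left_ne_zero_of_mul h))
      have hs : 0 < ∑ a', P a' y' :=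
        lt_of_lt_of_le hPx (Finset.single_le_sum
          (f := fun x' => P x' y') (fun i _ => hP i y') (Finset.mem_univ x))
      have hq := right_ne_zero_of_mul h
      rw [mul_assoc (P x y') (Q x y' y) (∑ a', P a' y'), mul_div_mul_left _ _ hPx.ne', Real.log_div (mul_ne_zero hq hs.ne') ho.ne',
        Real.log_mul hq hs.ne', Real.negMulLog]
      ring
  simp only [this, Finset.sum_sub_distrib, ← Finset.sum_mul]
  have e3 := sum_out (fun x y => Q x y' y) (fun x => hQ.2 x y') (fun x => P x y')
  rw [e3]
  simp only [Real.negMulLog, neg_mul, Finset.sum_neg_distrib]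
  ring

lemma exists_stationary [DecidableEq α] [Nonempty α] (K : α → α → ℝ) (hK0 : ∀ i j, 0 ≤ K i j)
    (hK1 : ∀ i, ∑ j, K i j = 1) :
    ∃ π : α → ℝ, IsPmf π ∧ ∀ j, ∑ i, π i * K i j = π j := by
  have hdet : (Matrix.of K - 1 : Matrix α α ℝ).det = 0 := by
    rw [← Matrix.exists_mulVec_eq_zero_iff]
    refine ⟨fun _ => 1, fun h => ?_, ?_⟩
    · have := congrFun h (Classical.arbitrary α); simp at this
    · ext i
      rw [Matrix.sub_mulVec, Matrix.one_mulVec]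
      simp [Matrix.mulVec, dotProduct, hK1]
  rw [← Matrix.exists_vecMul_eq_zero_iff] at hdet
  obtain ⟨v, hv, hv0⟩ := hdet
  have hv1 : ∀ j, ∑ i, v i * K i j = v j := by
    intro j
    have := congrFun hv0 j
    rw [Matrix.vecMul_sub, Matrix.vecMul_one] at this
    simp only [Matrix.vecMul, dotProduct, Pi.sub_apply, Matrix.of_apply, Pi.zero_apply] at this
    linarith
  have hle : ∀ j ∈ Finset.univ, |v j| ≤ ∑ i, |v i| * K i j := by
    intro j _
    rw [← hv1 j]
    refine (Finset.abs_sum_le_sum_abs _ _).trans (le_of_eq ?_)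
    refine Finset.sum_congr rfl fun i _ => ?_
    rw [abs_mul, abs_of_nonneg (hK0 i j)]
  have heq := (Finset.sum_eq_sum_iff_of_le hle).1 (sum_out K hK1 (fun i => |v i|)).symm
  have hpos : 0 < ∑ i, |v i| := by
    obtain ⟨i, hi⟩ := Function.ne_iff.1 hv
    exact Finset.sum_pos' (fun i _ => abs_nonneg _) ⟨i, Finset.mem_univ _, abs_pos.2 hi⟩
  refine ⟨fun i => |v i| / ∑ i, |v i|, ⟨fun i => by positivity, ?_⟩, fun j => ?_⟩
  · rw [← Finset.sum_div]; exact div_self hpos.ne'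
  · show ∑ i, |v i| / (∑ i, |v i|) * K i j = |v j| / ∑ i, |v i|
    conv_rhs => rw [heq j (Finset.mem_univ _), Finset.sum_div]
    exact Finset.sum_congr rfl fun i _ => by ring

lemma stationary_unique [Nonempty α] (K : α → α → ℝ) (hK : ∀ i j, 0 < K i j)
    (s t : α → ℝ) (ht : ∀ i, 0 < t i) (hs1 : ∑ i, s i = 1) (ht1 : ∑ i, t i = 1)
    (hs : ∀ j, ∑ i, s i * K i j = s j) (htt : ∀ j, ∑ i, t i * K i j = t j) : s = t := by
  obtain ⟨j, hj⟩ := Finite.exists_min (fun i => s i / t i)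
  set r := s j / t j with hr
  have hd : ∀ i, 0 ≤ s i - r * t i := by
    intro i
    have := hj i
    rw [le_div_iff₀ (ht i)] at this
    linarith
  have h0 : ∑ i, (s i - r * t i) * K i j = 0 := by
    have : ∑ i, (s i - r * t i) * K i j = s j - r * t j := by
      rw [← hs j, ← htt j, Finset.mul_sum, ← Finset.sum_sub_distrib]
      exact Finset.sum_congr rfl fun i _ => by ring
    rw [this, hr]; have := ht j; field_simp; ring
  have h1 : ∀ i, s i = r * t i := by
    intro i
    have := (Finset.sum_eq_zero_iff_of_nonneg
      (fun i _ => mul_nonneg (hd i) (hK i j).le)).1 h0 i (Finset.mem_univ _)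
    rcases mul_eq_zero.1 this with h | h
    · linarith
    · exact absurd h (hK i j).ne'
  have hr1 : r = 1 := by
    have : ∑ i, s i = r * ∑ i, t i := by
      rw [Finset.mul_sum]; exact Finset.sum_congr rfl fun i _ => h1 i
    rw [hs1, ht1] at this; linarith
  ext i; rw [h1, hr1, one_mul]

lemma inj_of_det [DecidableEq α] (V : α → α → ℝ)
    (h : ((Matrix.of fun y x => V x y) : Matrix α α ℝ).det ≠ 0)
    (u v : α → ℝ) (huv : ∀ y, ∑ x, u x * V x y = ∑ x, v x * V x y) : u = v := by
  by_contra hne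
  apply h
  rw [← Matrix.exists_mulVec_eq_zero_iff]
  refine ⟨u - v, sub_ne_zero.2 hne, ?_⟩
  ext y
  simp only [Matrix.mulVec, dotProduct, Matrix.of_apply, Pi.sub_apply, Pi.zero_apply, mul_sub,
    Finset.sum_sub_distrib]
  have := huv y
  simp only [mul_comm (u _), mul_comm (v _)] at this
  linarith

lemma W_pos [DecidableEq α] (W : α → α → ℝ) (hW0 : ∀ x y, 0 ≤ W x y)
    (hW1 : ∀ x, ∑ y : α, W x y = 1)
    (pX : α → ℝ) (hpX : IsPmf pX)
    (hpXopt : ∀ p : α → ℝ, IsPmf p → mlMI W p ≤ mlMI W pX)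
    (hpos : ∀ x, 0 < pX x)
    (hdet : ((Matrix.of fun y x => W x y) : Matrix α α ℝ).det ≠ 0)
    (P : α → α → ℝ) (hP : IsJointPmf P) (hst : StationaryFor (fun x _ y => W x y) P)
    (hF : Jfun W pX ≤ ∑ y', Jfun W (fun x => P x y')) (y' y : α) :
    0 < ∑ x, P x y' * W x y := by
  have hopt : ∀ p : α → ℝ, IsPmf p → Jfun W p ≤ Jfun W pX := fun p hp => by
    rw [← mlMI_eq W hW0 p hp, ← mlMI_eq W hW0 pX hpX]; exact hpXopt p hp
  have huniq : ∀ p : α → ℝ, IsPmf p → Jfun W p = Jfun W pX → p = pX := by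
    intro p hp he
    have hm := (Jfun_mid W hW0 hW1 p pX hp.1 hpX.1 (by rw [hp.2]; norm_num)
      (by rw [hpX.2]; norm_num)).2
    have hmid := hopt (fun x => (p x + pX x) / 2)
      ⟨fun x => by have := hp.1 x; have := hpX.1 x; positivity, by
        rw [← Finset.sum_div, Finset.sum_add_distrib, hp.2, hpX.2]; norm_num⟩
    apply inj_of_det W hdet
    intro z
    by_contra hz
    have := hm ⟨z, by rw [hp.2, hpX.2]; simpa using hz⟩
    linarith
  have hs0 : ∀ z, 0 ≤ ∑ x, P x z := fun z => Finset.sum_nonneg fun x _ => hP.1 x z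
  have hsum : ∑ z, ∑ x, P x z = 1 := by rw [Finset.sum_comm]; exact hP.2
  have hcase : ∀ z, Jfun W (fun x => P x z) ≤ (∑ x, P x z) * Jfun W pX ∧
      (Jfun W (fun x => P x z) = (∑ x, P x z) * Jfun W pX →
        ∀ x, P x z = (∑ x, P x z) * pX x) := by
    intro z
    rcases (hs0 z).eq_or_lt with h | h
    · have hz : ∀ x, P x z = 0 := fun x =>
        (Finset.sum_eq_zero_iff_of_nonneg (fun x _ => hP.1 x z)).1 h.symm x (Finset.mem_univ _)
      rw [Jfun_zero W _ hz, ← h]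
      simp [hz]
    · have hpm : IsPmf (fun x => P x z / ∑ x, P x z) :=
        ⟨fun x => div_nonneg (hP.1 x z) h.le, by
          rw [← Finset.sum_div]; exact div_self h.ne'⟩
      rw [Jfun_smul W hW1 _ h]
      refine ⟨mul_le_mul_of_nonneg_left (hopt _ hpm) h.le, fun he x => ?_⟩
      have := congrFun (huniq _ hpm (mul_left_cancel₀ h.ne' he)) x
      rw [← this]; field_simp
  have htot : ∑ z, (∑ x, P x z) * Jfun W pX = Jfun W pX := by
    rw [← Finset.sum_mul, hsum, one_mul]
  have heq := (Finset.sum_eq_sum_iff_of_le (fun z _ => (hcase z).1)).1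
    (le_antisymm (Finset.sum_le_sum fun z _ => (hcase z).1) (by rw [htot]; exact hF))
  have hPe : ∀ z x, P x z = (∑ x, P x z) * pX x := fun z =>
    (hcase z).2 (heq z (Finset.mem_univ _))
  have ho : ∀ z w, ∑ x, P x z * W x w = (∑ x, P x z) * ∑ x, pX x * W x w := by
    intro z w
    rw [Finset.mul_sum]
    refine Finset.sum_congr rfl fun x _ => ?_
    rw [← mul_assoc, ← hPe z x]
  have hs : ∀ w, ∑ x, P x w = ∑ x, pX x * W x w := by
    intro w
    rw [← hst w, Finset.sum_comm]
    simp only [ho]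
    rw [← Finset.sum_mul, hsum, one_mul]
  have hpY : ∀ w, 0 < ∑ x, pX x * W x w := by
    intro w
    refine lt_of_le_of_ne (Finset.sum_nonneg fun x _ => mul_nonneg (hpX.1 x) (hW0 x w)) ?_
    intro h
    have hz := (Finset.sum_eq_zero_iff_of_nonneg
      (fun x _ => mul_nonneg (hpX.1 x) (hW0 x w))).1 h.symm
    apply hdet
    apply Matrix.det_eq_zero_of_row_eq_zero w
    intro x
    exact (mul_eq_zero.1 (hz x (Finset.mem_univ _))).resolve_left (hpos x).ne'
  rw [ho, hs]
  exact mul_pos (hpY _) (hpY _)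

lemma feas_exists [DecidableEq α] [Nonempty α] (Q : α → α → α → ℝ) (hQ : IsPOST Q)
    (pX : α → ℝ) (hpX : IsPmf pX) :
    ∃ P, IsJointPmf P ∧ StationaryFor Q P ∧ ∃ z,
      Jfun (fun x y => Q x z y) pX ≤ ∑ y', Jfun (fun x y => Q x y' y) (fun x => P x y') := by
  obtain ⟨π, hπ, hst⟩ := exists_stationary (fun y' y => ∑ x, pX x * Q x y' y)
    (fun y' y => Finset.sum_nonneg fun x _ => mul_nonneg (hpX.1 x) (hQ.1 x y' y))
    (fun y' => by
      have := sum_out (fun x y => Q x y' y) (fun x => hQ.2 x y') pX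
      rw [this, hpX.2])
  have hmarg : ∀ z, ∑ x, pX x * π z = π z := fun z => by
    rw [← Finset.sum_mul, hpX.2, one_mul]
  refine ⟨fun x y' => pX x * π y', ⟨fun x y => mul_nonneg (hpX.1 x) (hπ.1 y), ?_⟩, ?_, ?_⟩
  · simp only [← Finset.mul_sum, hπ.2, mul_one, hpX.2]
  · intro y
    simp only [hmarg]
    rw [Finset.sum_comm, ← hst y]
    refine Finset.sum_congr rfl fun y' _ => ?_
    rw [Finset.mul_sum]
    exact Finset.sum_congr rfl fun x _ => by ring
  · obtain ⟨z, hz⟩ := Finite.exists_min (fun z => Jfun (fun x y => Q x z y) pX)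
    refine ⟨z, ?_⟩
    have : ∀ y', Jfun (fun x y => Q x y' y) (fun x => pX x * π y')
        = π y' * Jfun (fun x y => Q x y' y) pX := by
      intro y'
      rcases (hπ.1 y').eq_or_lt with h | h
      · rw [Jfun_zero _ _ (by simp [← h]), ← h, zero_mul]
      · rw [Jfun_smul (fun x y => Q x y' y) (fun x => hQ.2 x y') _ (by rw [hmarg]; exact h), hmarg]
        congr 2
        ext x; field_simp
    simp only [this]
    calc Jfun (fun x y => Q x z y) pX = ∑ y', π y' * Jfun (fun x y => Q x z y) pX := by
          rw [← Finset.sum_mul, hπ.2, one_mul]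
      _ ≤ _ := Finset.sum_le_sum fun y' _ => mul_le_mul_of_nonneg_left (hz y') (hπ.1 y')

/-- The total functional in continuous form. -/
def Ffun (Q : α → α → α → ℝ) (P : α → α → ℝ) : ℝ :=
  ∑ y', Jfun (fun x y => Q x y' y) (fun x => P x y')

lemma Ffun_cont : Continuous (fun z : (α → α → α → ℝ) × (α → α → ℝ) => Ffun z.1 z.2) := by
  unfold Ffun Jfun
  fun_prop

lemma JQ_cont (pX : α → ℝ) (w : α) :
    Continuous (fun z : (α → α → α → ℝ) × (α → α → ℝ) =>
      Jfun (fun x y => z.1 x w y) pX) := by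
  unfold Jfun
  fun_prop

lemma feas_compact : IsCompact {z : (α → α → α → ℝ) × (α → α → ℝ) |
    IsPOST z.1 ∧ IsJointPmf z.2 ∧ StationaryFor z.1 z.2} := by
  have hc : IsCompact (Set.Icc (0 : (α → α → α → ℝ) × (α → α → ℝ)) 1) := isCompact_Icc
  refine hc.of_isClosed_subset ?_ ?_
  · simp only [IsPOST, IsJointPmf, StationaryFor, Set.ofPred_and, Set.ofPred_forall]
    refine ((isClosed_iInter fun x => isClosed_iInter fun y' => isClosed_iInter fun y => ?_).inter
      (isClosed_iInter fun x => isClosed_iInter fun y' => ?_)).inter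
      (((isClosed_iInter fun x => isClosed_iInter fun y' => ?_).inter ?_).inter
      (isClosed_iInter fun y => ?_))
    · exact isClosed_le (by fun_prop) (by fun_prop)
    · exact isClosed_eq (by fun_prop) (by fun_prop)
    · exact isClosed_le (by fun_prop) (by fun_prop)
    · exact isClosed_eq (by fun_prop) (by fun_prop)
    · exact isClosed_eq (by fun_prop) (by fun_prop)
  · rintro ⟨Q, P⟩ ⟨hQ, hP, -⟩
    refine ⟨⟨fun x y' y => hQ.1 x y' y, fun x y => hP.1 x y⟩,
      ⟨fun x y' y => ?_, fun x y => ?_⟩⟩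
    · show Q x y' y ≤ 1
      rw [← hQ.2 x y']
      exact Finset.single_le_sum (f := fun y => Q x y' y) (fun i _ => hQ.1 x y' i)
        (Finset.mem_univ y)
    · show P x y ≤ 1
      rw [← hP.2]
      exact (Finset.single_le_sum (f := fun y => P x y) (fun i _ => hP.1 x i)
        (Finset.mem_univ y)).trans
        (Finset.single_le_sum (f := fun x => ∑ y, P x y)
          (fun i _ => Finset.sum_nonneg fun j _ => hP.1 i j) (Finset.mem_univ x))

lemma exists_max [DecidableEq α] [Nonempty α] (Q : α → α → α → ℝ) (hQ : IsPOST Q)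
    (pX : α → ℝ) (hpX : IsPmf pX) : ∃ P, IsFbMaximizer Q P := by
  obtain ⟨P0, h0, h0', -⟩ := feas_exists Q hQ pX hpX
  have hc : IsCompact ({z : (α → α → α → ℝ) × (α → α → ℝ) |
    IsPOST z.1 ∧ IsJointPmf z.2 ∧ StationaryFor z.1 z.2} ∩ {z | z.1 = Q}) :=
    feas_compact.inter_right (isClosed_eq continuous_fst continuous_const)
  obtain ⟨⟨Q', P⟩, ⟨⟨-, hP, hS⟩, hQQ⟩, hmax⟩ := hc.exists_isMaxOn
    ⟨(Q, P0), ⟨hQ, h0, h0'⟩, rfl⟩ Ffun_cont.continuousOn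
  have hQQ' : Q' = Q := hQQ
  subst hQQ'
  refine ⟨P, hP, hS, fun P' h1 h2 => ?_⟩
  rw [fbMI_eq Q' hQ P' h1.1, fbMI_eq Q' hQ P hP.1]
  exact isMaxOn_iff.1 hmax (Q', P') ⟨⟨hQ, h1, h2⟩, rfl⟩

lemma uniq_of_pos [DecidableEq α] [Nonempty α] (Q : α → α → α → ℝ) (hQ : IsPOST Q)
    (hdet : ∀ y', ((Matrix.of fun y x => Q x y' y) : Matrix α α ℝ).det ≠ 0)
    (P R : α → α → ℝ) (hP : IsFbMaximizer Q P) (hR : IsFbMaximizer Q R)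
    (hPo : ∀ y' y, 0 < ∑ x, P x y' * Q x y' y) (hRo : ∀ y' y, 0 < ∑ x, R x y' * Q x y' y) :
    P = R := by
  have marg : ∀ (S : α → α → ℝ) y', ∑ y, ∑ x, S x y' * Q x y' y = ∑ x, S x y' := fun S y' =>
    sum_out (fun x y => Q x y' y) (fun x => hQ.2 x y') (fun x => S x y')
  have hPs : ∀ y', 0 < ∑ x, P x y' := fun y' => by
    rw [← marg]; exact Finset.sum_pos (fun y _ => hPo y' y) Finset.univ_nonempty
  have hRs : ∀ y', 0 < ∑ x, R x y' := fun y' => by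
    rw [← marg]; exact Finset.sum_pos (fun y _ => hRo y' y) Finset.univ_nonempty
  obtain ⟨hPp, hPst, hPm⟩ := hP
  obtain ⟨hRp, hRst, hRm⟩ := hR
  have hMp : IsJointPmf (fun x y => (P x y + R x y) / 2) := by
    refine ⟨fun x y => by have := hPp.1 x y; have := hRp.1 x y; positivity, ?_⟩
    simp only [← Finset.sum_div, Finset.sum_add_distrib, hPp.2, hRp.2]
    norm_num
  have hMst : StationaryFor Q (fun x y => (P x y + R x y) / 2) := by
    intro y
    have h1 := hPst y
    have h2 := hRst y
    have : ∀ x y', (P x y' + R x y') / 2 * Q x y' y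
      = (P x y' * Q x y' y + R x y' * Q x y' y) / 2 := fun x y' => by ring
    simp only [this, ← Finset.sum_div, Finset.sum_add_distrib, h1, h2]
  have hle1 := hPm _ hMp hMst
  have hle2 := hRm _ hMp hMst
  rw [fbMI_eq Q hQ _ hMp.1, fbMI_eq Q hQ P hPp.1] at hle1
  rw [fbMI_eq Q hQ _ hMp.1, fbMI_eq Q hQ R hRp.1] at hle2
  have hmid := fun y' => Jfun_mid (fun x y => Q x y' y) (fun x y => hQ.1 x y' y)
    (fun x => hQ.2 x y') (fun x => P x y') (fun x => R x y') (fun x => hPp.1 x y')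
    (fun x => hRp.1 x y') (hPs y') (hRs y')
  have hratio : ∀ y' y, (∑ x, P x y' * Q x y' y) / (∑ x, P x y')
      = (∑ x, R x y' * Q x y' y) / (∑ x, R x y') := by
    by_contra hcon
    push Not at hcon
    obtain ⟨y', y, hne⟩ := hcon
    have hlt := Finset.sum_lt_sum (s := Finset.univ) (fun z _ => (hmid z).1)
      ⟨y', Finset.mem_univ _, (hmid y').2 ⟨y, hne⟩⟩
    rw [← Finset.sum_div, Finset.sum_add_distrib] at hlt
    linarith
  have hs : (fun y' => ∑ x, P x y') = fun y' => ∑ x, R x y' := by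
    refine stationary_unique (fun y' y => (∑ x, P x y' * Q x y' y) / (∑ x, P x y'))
      (fun y' y => div_pos (hPo y' y) (hPs y')) _ _ hRs ?_ ?_ ?_ ?_
    · rw [Finset.sum_comm]; exact hPp.2
    · rw [Finset.sum_comm]; exact hRp.2
    · intro y
      rw [← hPst y, Finset.sum_comm]
      exact Finset.sum_congr rfl fun y' _ => mul_div_cancel₀ _ (hPs y').ne'
    · intro y
      simp only [hratio]
      rw [← hRst y, Finset.sum_comm]
      exact Finset.sum_congr rfl fun y' _ => mul_div_cancel₀ _ (hRs y').ne'
  ext x y'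
  refine congrFun (inj_of_det (fun x y => Q x y' y) (hdet y') (fun x => P x y')
    (fun x => R x y') ?_) x
  intro y
  have h1 := hratio y' y
  have h2 := congrFun hs y'
  rw [h2] at h1
  exact (div_left_inj' (hRs y').ne').1 h1

end helpers

/-- For a memoryless surjective channel `W` with `|𝒳| = |𝒴|`
(so both alphabets are the same finite set `α`, surjectivity reducing to positivity
of the capacity-achieving input distribution and invertibility of `W`), there is
`δ > 0` such that for every `W`-centered `δ`-approximately memoryless POST channel
`Q`, the optimization problem defining `C*_f(Q)` has a unique maximizer. -/
theorem unique_maximizer_equal_alphabets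
    {α : Type*} [Fintype α] [DecidableEq α] (hα : 2 ≤ Fintype.card α)
    (W : α → α → ℝ) (hW0 : ∀ x y, 0 ≤ W x y) (hW1 : ∀ x, ∑ y : α, W x y = 1)
    (pX : α → ℝ) (hpX : IsPmf pX)
    (hpXopt : ∀ p : α → ℝ, IsPmf p → mlMI W p ≤ mlMI W pX)
    (hpos : ∀ x, 0 < pX x)
    (hinv : IsUnit ((Matrix.of fun y x => W x y) : Matrix α α ℝ)) :
    ∃ δ > (0 : ℝ), ∀ Q : α → α → α → ℝ, IsPOST Q →
      (∀ x y' y, |Q x y' y - W x y| ≤ δ) →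
      ∃! P : α → α → ℝ, IsFbMaximizer Q P := by
  classical
  have : Nonempty α := Fintype.card_pos_iff.1 (by omega)
  have hdetW : ((Matrix.of fun y x => W x y) : Matrix α α ℝ).det ≠ 0 :=
    ((Matrix.isUnit_iff_isUnit_det _).1 hinv).ne_zero
  set W0 : α → α → α → ℝ := fun x _ y => W x y with hW0def
  set B : Set ((α → α → α → ℝ) × (α → α → ℝ)) :=
    {z | IsPOST z.1 ∧ IsJointPmf z.2 ∧ StationaryFor z.1 z.2} ∩
      ⋃ w : α × α × α, {z | ∑ x, z.2 x w.1 * z.1 x w.1 w.2.1 ≤ 0} ∩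
        {z | Jfun (fun x y => z.1 x w.2.2 y) pX ≤ Ffun z.1 z.2} with hB
  have hBc : IsCompact B := by
    refine feas_compact.inter_right (isClosed_iUnion_of_finite fun w => ?_)
    exact (isClosed_le (by fun_prop) (by fun_prop)).inter
      (isClosed_le (JQ_cont pX w.2.2) Ffun_cont)
  have hIc : IsClosed (Set.image Prod.fst B) := (hBc.image continuous_fst).isClosed
  have hWn : W0 ∉ Set.image Prod.fst B := by
    rintro ⟨⟨Q, P⟩, ⟨⟨-, hP, hS⟩, hU⟩, hQ⟩
    simp only at hQ hP hS
    subst hQ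
    obtain ⟨⟨y', y, w⟩, h1, h2⟩ := Set.mem_iUnion.1 hU
    have := W_pos W hW0 hW1 pX hpX hpXopt hpos hdetW P hP hS h2 y' y
    exact absurd h1 (not_le.2 this)
  have hDo : IsOpen {Q : α → α → α → ℝ |
      ∀ y', ((Matrix.of fun y x => Q x y' y) : Matrix α α ℝ).det ≠ 0} := by
    simp only [Set.ofPred_forall]
    refine isOpen_iInter_of_finite fun y' => ?_
    refine isOpen_ne_fun (Continuous.matrix_det ?_) continuous_const
    exact continuous_matrix fun i j => by simp only [Matrix.of_apply]; fun_prop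
  have hO := hIc.isOpen_compl.inter hDo
  obtain ⟨ε, hε, hball⟩ := Metric.isOpen_iff.1 hO W0 ⟨hWn, fun _ => hdetW⟩
  refine ⟨ε / 2, half_pos hε, fun Q hQ hclose => ?_⟩
  have hQmem : Q ∈ Metric.ball W0 ε := by
    rw [Metric.mem_ball]
    refine lt_of_le_of_lt ?_ (half_lt_self hε)
    have h2 := (half_pos hε).le
    refine (dist_pi_le_iff h2).2 fun x => (dist_pi_le_iff h2).2 fun y' =>
      (dist_pi_le_iff h2).2 fun y => ?_
    rw [Real.dist_eq]; exact hclose x y' y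
  obtain ⟨hQn, hQd⟩ := hball hQmem
  have hposs : ∀ P, IsFbMaximizer Q P → ∀ y' y, 0 < ∑ x, P x y' * Q x y' y := by
    intro P hP y' y
    by_contra hle
    push Not at hle
    apply hQn
    obtain ⟨P0, h0, h0', w, hw⟩ := feas_exists Q hQ pX hpX
    refine ⟨(Q, P), ⟨⟨hQ, hP.1, hP.2.1⟩, Set.mem_iUnion.2 ⟨(y', y, w), hle, ?_⟩⟩, rfl⟩
    have := hP.2.2 P0 h0 h0'
    rw [fbMI_eq Q hQ P0 h0.1, fbMI_eq Q hQ P hP.1.1] at this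
    exact hw.trans this
  obtain ⟨P, hP⟩ := exists_max Q hQ pX hpX
  exact ⟨P, hP, fun R hR => uniq_of_pos Q hQ hQd R P hR hP (hposs R hR) (hposs P hP)⟩
end
end
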